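/- Let R = ℤ[τ][1/(τ−1)], and let μ_τ : Θ(𝔗) → R be the ring homomorphism obtained by composing the isomorphism Θ(𝔗) ≅ ℤ[u,v]/(uv) with the homomorphism ℤ[u,v]/(uv) → R sending u ↦ −(τ−2)/(τ−1) and v ↦ 0. Then for every reduced tree T, the image under μ_τ of the class in Θ(𝔗) of the embedding ∅ → L(T) equals (−1)^{n(T)} · τ · (τ−1)^{−ℓ(T)} · ∏_x [τ]_{v(x)}, where the product is over the nodes x of T. -/

import Mathlib

/-! # Relational structures, embeddings, amalgamations, Fraïssé classes -/

namespace Paper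

/-- A relational signature: a set `I` of relation symbols with arities `≥ 1`. -/
structure Signature : Type 1 where
  I : Type
  arity : I → ℕ
  arity_pos : ∀ i, 1 ≤ arity i

variable {σ : Signature}

/-- A (finite relational) structure for the signature `σ`. -/
structure Struc (σ : Signature) : Type 1 where
  carrier : Type
  [fin : Finite carrier]
  rel : ∀ i : σ.I, (Fin (σ.arity i) → carrier) → Prop

attribute [instance] Struc.fin

/-- An embedding of structures: an injection under which the relations on the source are
exactly the restrictions of the relations on the target. -/
structure Emb (X Y : Struc σ) : Type where
  toFun : X.carrier → Y.carrier
  inj : Function.Injective toFun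
  rel_iff : ∀ (i : σ.I) (v : Fin (σ.arity i) → X.carrier),
    Y.rel i (fun j => toFun (v j)) ↔ X.rel i v

/-- The identity embedding. -/
def Emb.id (X : Struc σ) : Emb X X where
  toFun := fun x => x
  inj := fun _ _ h => h
  rel_iff := fun _ _ => Iff.rfl

/-- Composition of embeddings. -/
def Emb.comp {X Y Z : Struc σ} (g : Emb Y Z) (f : Emb X Y) : Emb X Z where
  toFun := fun x => g.toFun (f.toFun x)
  inj := fun _ _ h => f.inj (g.inj h)
  rel_iff := fun i v => (g.rel_iff i fun j => f.toFun (v j)).trans (f.rel_iff i v)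

/-- An embedding is an isomorphism if it is surjective. -/
def Emb.IsIso {X Y : Struc σ} (f : Emb X Y) : Prop := Function.Surjective f.toFun

/-- Two structures are isomorphic. -/
def StrucIso (X Y : Struc σ) : Prop := ∃ f : Emb X Y, f.IsIso

theorem strucIso_refl (X : Struc σ) : StrucIso X X := ⟨Emb.id X, fun y => ⟨y, rfl⟩⟩

/-- The induced structure on a subset of the carrier. -/
def Struc.restrict (X : Struc σ) (S : Set X.carrier) : Struc σ where
  carrier := S
  rel := fun i v => X.rel i (fun j => (v j : X.carrier))

/-- The inclusion embedding of an induced substructure into the whole structure. -/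
def Struc.subEmb (X : Struc σ) (S : Set X.carrier) : Emb (X.restrict S) X where
  toFun := fun a => a.1
  inj := fun _ _ h => Subtype.ext h
  rel_iff := fun _ _ => Iff.rfl

/-- The inclusion embedding between induced substructures on nested subsets. -/
def Struc.inclEmb (X : Struc σ) {S T : Set X.carrier} (h : S ⊆ T) :
    Emb (X.restrict S) (X.restrict T) where
  toFun := fun a => ⟨a.1, h a.2⟩
  inj := fun a b hab => Subtype.ext (Subtype.mk_eq_mk.mp (by exact hab))
  rel_iff := fun _ _ => Iff.rfl

/-- An amalgamation of `Y₁` and `Y₂` over `X` (along `i₁`, `i₂`). -/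
structure Amalg {X Y₁ Y₂ : Struc σ} (i₁ : Emb X Y₁) (i₂ : Emb X Y₂) : Type 1 where
  Z : Struc σ
  j₁ : Emb Y₁ Z
  j₂ : Emb Y₂ Z
  comm : ∀ x, j₁.toFun (i₁.toFun x) = j₂.toFun (i₂.toFun x)
  surj : ∀ z, z ∈ Set.range j₁.toFun ∪ Set.range j₂.toFun

/-- Isomorphism of amalgamations: a structure isomorphism commuting with the two
embeddings. -/
def Amalg.Iso {X Y₁ Y₂ : Struc σ} {i₁ : Emb X Y₁} {i₂ : Emb X Y₂}
    (A B : Amalg i₁ i₂) : Prop :=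
  ∃ f : Emb A.Z B.Z, f.IsIso ∧ (∀ y, f.toFun (A.j₁.toFun y) = B.j₁.toFun y) ∧
    (∀ y, f.toFun (A.j₂.toFun y) = B.j₂.toFun y)

/-- A structure lies in the class `F` up to isomorphism. -/
def MemUpIso (F : Set (Struc σ)) (X : Struc σ) : Prop := ∃ W ∈ F, StrucIso X W

theorem memUpIso_of_mem {F : Set (Struc σ)} {X : Struc σ} (h : X ∈ F) : MemUpIso F X :=
  ⟨X, h, strucIso_refl X⟩

/-- A Fraïssé class. -/
structure IsFraisse (F : Set (Struc σ)) : Prop where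
  nonempty : F.Nonempty
  finClasses : ∀ n : ℕ, ∃ (m : ℕ) (r : Fin m → Struc σ),
    ∀ X ∈ F, Nat.card X.carrier = n → ∃ α, StrucIso X (r α)
  hereditary : ∀ X ∈ F, ∀ Y : Struc σ, Nonempty (Emb Y X) → MemUpIso F Y
  amalg : ∀ (X Y₁ Y₂ : Struc σ), X ∈ F → Y₁ ∈ F → Y₂ ∈ F →
    ∀ (i₁ : Emb X Y₁) (i₂ : Emb X Y₂), ∃ A : Amalg i₁ i₂, MemUpIso F A.Z

theorem pair_compl_subset_left {α : Type*} (a b : α) : ({a, b} : Set α)ᶜ ⊆ ({a} : Set α)ᶜ :=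
  Set.compl_subset_compl.mpr (fun _ hx => Set.mem_insert_iff.mpr (Or.inl hx))

theorem pair_compl_subset_right {α : Type*} (a b : α) : ({a, b} : Set α)ᶜ ⊆ ({b} : Set α)ᶜ :=
  Set.compl_subset_compl.mpr (fun _ hx => Set.mem_insert_iff.mpr (Or.inr hx))

/-- The canonical amalgamation of `X∖{a}` and `X∖{b}` over `X∖{a,b}`, namely `X` itself. -/
def canonAmalg (X : Struc σ) (a b : X.carrier) (hab : a ≠ b) :
    Amalg (X.inclEmb (pair_compl_subset_left a b)) (X.inclEmb (pair_compl_subset_right a b)) where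
  Z := X
  j₁ := X.subEmb ({a} : Set X.carrier)ᶜ
  j₂ := X.subEmb ({b} : Set X.carrier)ᶜ
  comm := fun _ => rfl
  surj := fun z => by
    by_cases hz : z = a
    · exact Or.inr ⟨⟨z, by simp only [Set.mem_compl_iff, Set.mem_singleton_iff, hz]; exact hab⟩, rfl⟩
    · exact Or.inl ⟨⟨z, by simp [hz]⟩, rfl⟩

/-- Two distinct elements `a b` of `X` are separated (relative to the class `F`) if `X` is,
up to isomorphism of amalgamations, the unique amalgamation of `X∖{a}` and `X∖{b}` over
`X∖{a,b}` lying in `F`. -/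
def Separated (F : Set (Struc σ)) (X : Struc σ) (a b : X.carrier) (hab : a ≠ b) : Prop :=
  ∀ A : Amalg (X.inclEmb (pair_compl_subset_left a b)) (X.inclEmb (pair_compl_subset_right a b)),
    MemUpIso F A.Z → A.Iso (canonAmalg X a b hab)

/-- Stably separated: every embedding into a member of `F` sends `a`, `b` to separated
elements. -/
def StablySeparated (F : Set (Struc σ)) (X : Struc σ) (a b : X.carrier) (hab : a ≠ b) : Prop :=
  ∀ X' : Struc σ, MemUpIso F X' → ∀ f : Emb X X',
    Separated F X' (f.toFun a) (f.toFun b) (fun h => hab (f.inj h))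

/-- Isomorphism of marked structures. -/
def MarkedIso (X : Struc σ) (a : X.carrier) (Y : Struc σ) (b : Y.carrier) : Prop :=
  ∃ f : Emb X Y, f.IsIso ∧ f.toFun a = b

/-- `b` is extraneous in the marked structure `(X, a)` if it is separated from `a`. -/
def Extraneous (F : Set (Struc σ)) (X : Struc σ) (a b : X.carrier) : Prop :=
  ∃ h : a ≠ b, Separated F X a b h

/-- A marked structure is minimal if it has no extraneous elements. -/
def MinimalMarked (F : Set (Struc σ)) (X : Struc σ) (a : X.carrier) : Prop :=
  ∀ b : X.carrier, ¬ Extraneous F X a b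

/-- `f : W → X` is a one-point extension missing exactly `a`. -/
def IsOnePointExt {W X : Struc σ} (f : Emb W X) (a : X.carrier) : Prop :=
  Set.range f.toFun = ({a} : Set X.carrier)ᶜ

end Paper

/-! # Trees and tree structures -/

namespace Paper

/-- A finite tree: a finite connected acyclic simple graph. -/
structure FinTree : Type 1 where
  V : Type
  [fin : Fintype V]
  [dec : DecidableEq V]
  G : SimpleGraph V
  [adjDec : DecidableRel G.Adj]
  isTree : G.IsTree

attribute [instance] FinTree.fin FinTree.dec FinTree.adjDec

/-- A leaf is a vertex of valence `≤ 1` (in a tree with at least two vertices this is the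
same as valence exactly `1`; in a tree with at most two vertices every vertex is a leaf). -/
def FinTree.IsLeaf (T : FinTree) (v : T.V) : Prop := T.G.degree v ≤ 1

instance (T : FinTree) : DecidablePred T.IsLeaf := fun v => by
  unfold FinTree.IsLeaf; infer_instance

/-- A node is a vertex which is not a leaf. -/
def FinTree.IsNode (T : FinTree) (v : T.V) : Prop := ¬ T.IsLeaf v

/-- A tree is reduced if it has no node of valence 2. -/
def FinTree.Reduced (T : FinTree) : Prop := ∀ v : T.V, T.G.degree v ≠ 2

/-- The quaternary relation on the vertices of a tree: the four vertices are pairwise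
distinct and the path from `x₁` to `x₂` has a common edge with the path from `y₁` to
`y₂`. -/
def FinTree.pathRel (T : FinTree) (x₁ x₂ y₁ y₂ : T.V) : Prop :=
  ([x₁, x₂, y₁, y₂] : List T.V).Nodup ∧
  ∃ (p : T.G.Walk x₁ x₂) (q : T.G.Walk y₁ y₂), p.IsPath ∧ q.IsPath ∧
    ∃ e : Sym2 T.V, e ∈ p.edges ∧ e ∈ q.edges

/-- The signature of tree structures: a single quaternary relation. -/
abbrev treeSig : Signature where
  I := Unit
  arity := fun _ => 4
  arity_pos := fun _ => by norm_num

/-- The leaf structure `L(T)` of a tree `T`: the set of leaves together with the quaternary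
relation `R(x₁,x₂;y₁,y₂)` expressing that the paths `x₁–x₂` and `y₁–y₂` share an edge. -/
def FinTree.leafStruc (T : FinTree) : Struc treeSig where
  carrier := {v : T.V // T.IsLeaf v}
  rel := fun _ v => T.pathRel (v 0).1 (v 1).1 (v 2).1 (v 3).1

/-- The class `𝔗` of all tree structures (together with the empty structure, the leaf
structure of the empty tree). -/
def TreeClass : Set (Struc treeSig) :=
  {A | IsEmpty A.carrier ∨ ∃ T : FinTree, StrucIso A T.leafStruc}

/-- The level of a tree is at most `n`: every vertex has valence at most `n`. -/
def FinTree.LevelLe (T : FinTree) (n : ℕ) : Prop := ∀ v : T.V, T.G.degree v ≤ n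

/-- The class `𝔗_n` of tree structures of level at most `n`. -/
def TreeClassN (n : ℕ) : Set (Struc treeSig) :=
  {A | IsEmpty A.carrier ∨ ∃ T : FinTree, T.LevelLe n ∧ StrucIso A T.leafStruc}

theorem leafStruc_mem_treeClass (T : FinTree) : T.leafStruc ∈ TreeClass :=
  Or.inr ⟨T, strucIso_refl _⟩

/-- The set of leaves of a tree. -/
def FinTree.leafFinset (T : FinTree) : Finset T.V := Finset.univ.filter T.IsLeaf

/-- The number of leaves, `ℓ(T)`. -/
def FinTree.nLeaves (T : FinTree) : ℕ := T.leafFinset.card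

/-- The set of nodes of a tree. -/
def FinTree.nodeFinset (T : FinTree) : Finset T.V := Finset.univ.filter (fun v => ¬ T.IsLeaf v)

/-- The number of nodes, `n(T)`. -/
def FinTree.nNodes (T : FinTree) : ℕ := T.nodeFinset.card

end Paper

/-! # The marked trees `X_m`, `Y`, `Z` (via their leaf structures) -/

namespace Paper

/-- The leaf structure of the star tree `X_m` (one central node adjacent to `m` leaves; for
`m ≤ 2` the tree with `m` vertices): `m` leaves and the empty quaternary relation. -/
def XmStruc (m : ℕ) : Struc treeSig where
  carrier := Fin m
  rel := fun _ _ => False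

/-- `(X, a)` is isomorphic as a marked structure to the marked leaf structure of the star
`X_m` (marked at one of its leaves). -/
def IsMarkedXm (m : ℕ) (hm : 0 < m) (X : Struc treeSig) (a : X.carrier) : Prop :=
  ∃ f : Emb (XmStruc m) X, f.IsIso ∧ f.toFun ⟨0, hm⟩ = a

/-- The leaf structure of the tree `Y`: two adjacent valence-3 nodes, each additionally
adjacent to two leaves.  Leaves `0,1` hang off the first node and `2,3` off the second;
`R(x₁,x₂;y₁,y₂)` holds iff all four are distinct and both paths cross the middle edge. -/
def YStruc : Struc treeSig where
  carrier := Fin 4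
  rel := fun _ v => Function.Injective v ∧
    ((((v 0 : Fin 4) : ℕ) < 2 ↔ ¬ (((v 1 : Fin 4) : ℕ) < 2)) ∧
     ((((v 2 : Fin 4) : ℕ) < 2 ↔ ¬ (((v 3 : Fin 4) : ℕ) < 2))))

/-- `(X, a)` is isomorphic as a marked structure to the marked leaf structure of `Y`. -/
def IsMarkedY (X : Struc treeSig) (a : X.carrier) : Prop :=
  ∃ f : Emb YStruc X, f.IsIso ∧ f.toFun (0 : Fin 4) = a

/-- `x` is a leaf adjacent to the node `A` of the tree `Z` below. -/
def ZsideA (x : Fin 5) : Prop := (x : ℕ) < 2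

/-- `x` is a leaf adjacent to the node `C` of the tree `Z` below. -/
def ZsideC (x : Fin 5) : Prop := 2 ≤ (x : ℕ) ∧ (x : ℕ) < 4

/-- The leaf structure of the tree `Z`: three valence-3 nodes forming a path `A–B–C`, with
leaves `0,1` adjacent to `A`, leaves `2,3` adjacent to `C` and leaf `4` adjacent to `B`.
`R(x₁,x₂;y₁,y₂)` holds iff all four are distinct and both paths cross the edge `A–B`, or
both paths cross the edge `B–C`. -/
def ZStruc : Struc treeSig where
  carrier := Fin 5
  rel := fun _ v => Function.Injective v ∧
    (((ZsideA (v 0) ↔ ¬ ZsideA (v 1)) ∧ (ZsideA (v 2) ↔ ¬ ZsideA (v 3))) ∨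
     ((ZsideC (v 0) ↔ ¬ ZsideC (v 1)) ∧ (ZsideC (v 2) ↔ ¬ ZsideC (v 3))))

/-- `(X, a)` is isomorphic as a marked structure to the marked leaf structure of `Z`
(marked at the leaf adjacent to the middle node). -/
def IsMarkedZ (X : Struc treeSig) (a : X.carrier) : Prop :=
  ∃ f : Emb ZStruc X, f.IsIso ∧ f.toFun (4 : Fin 5) = a

end Paper

/-! # The ring `Θ(𝔉)` of a Fraïssé class -/

namespace Paper

variable {σ : Signature}

/-- Generators of `Θ(𝔉)`: one for each embedding between members of `𝔉`. -/
def ThetaGen (F : Set (Struc σ)) : Type 1 :=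
  Σ (X : {X : Struc σ // X ∈ F}) (Y : {Y : Struc σ // Y ∈ F}), Emb X.1 Y.1

/-- The polynomial ring on the generators of `Θ(𝔉)`. -/
abbrev ThetaPoly (F : Set (Struc σ)) := MvPolynomial (ThetaGen F) ℤ

/-- The generator `[i]` for an embedding `i : X → Y` between members of `𝔉`. -/
noncomputable def thetaVar {F : Set (Struc σ)} (X Y : Struc σ) (hX : X ∈ F) (hY : Y ∈ F)
    (f : Emb X Y) : ThetaPoly F :=
  MvPolynomial.X ⟨⟨X, hX⟩, ⟨Y, hY⟩, f⟩

/-- The defining relations of `Θ(𝔉)`: `[i] = 1` for isomorphisms, `[j∘i] = [j]·[i]`,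
and the amalgamation relations `[i] = Σ_α [i'_α]` where `i'_α` runs over a complete
irredundant system of representatives of the isomorphism classes of amalgamations
lying in `𝔉`. -/
def ThetaRels (F : Set (Struc σ)) : Set (ThetaPoly F) :=
  {p | ∃ (X Y : Struc σ) (hX : X ∈ F) (hY : Y ∈ F) (f : Emb X Y),
      f.IsIso ∧ p = thetaVar X Y hX hY f - 1} ∪
  {p | ∃ (X Y Z : Struc σ) (hX : X ∈ F) (hY : Y ∈ F) (hZ : Z ∈ F)
      (f : Emb X Y) (g : Emb Y Z),
      p = thetaVar X Z hX hZ (g.comp f) - thetaVar Y Z hY hZ g * thetaVar X Y hX hY f} ∪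
  {p | ∃ (X Y X' : Struc σ) (hX : X ∈ F) (hY : Y ∈ F) (hX' : X' ∈ F)
      (i : Emb X Y) (f : Emb X X') (m : ℕ) (r : Fin m → Amalg i f)
      (hr : ∀ α, (r α).Z ∈ F),
      (∀ A : Amalg i f, MemUpIso F A.Z → ∃ α, A.Iso (r α)) ∧
      (∀ α β, (r α).Iso (r β) → α = β) ∧
      p = thetaVar X Y hX hY i - ∑ α, thetaVar X' (r α).Z hX' (hr α) ((r α).j₂)}

/-- The ring `Θ(𝔉)`. -/
abbrev ThetaRing (F : Set (Struc σ)) : Type 1 :=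
  ThetaPoly F ⧸ Ideal.span (ThetaRels F)

/-- The class `[i] ∈ Θ(𝔉)` of an embedding between members of `𝔉`. -/
noncomputable def thetaClass {F : Set (Struc σ)} (X Y : Struc σ) (hX : X ∈ F) (hY : Y ∈ F)
    (f : Emb X Y) : ThetaRing F :=
  Ideal.Quotient.mk _ (thetaVar X Y hX hY f)

end Paper

namespace Paper

/-- The polynomial `u ∈ ℤ[u,v]`. -/
noncomputable def uP : MvPolynomial (Fin 2) ℤ := MvPolynomial.X 0

/-- The polynomial `v ∈ ℤ[u,v]`. -/
noncomputable def vP : MvPolynomial (Fin 2) ℤ := MvPolynomial.X 1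

/-- The ring `ℤ[u,v]/(uv)`. -/
abbrev UVQuot : Type := MvPolynomial (Fin 2) ℤ ⧸ Ideal.span {uP * vP}

/-- The map `e` sends the class `[X,a]` of every marked tree structure isomorphic to the
marked pattern `(Pat, pt)` to the image of `val` in `ℤ[u,v]/(uv)`.  Here `[X,a]` is the
class in `Θ(𝔗)` of any one-point extension `W → X` (with `W ∈ 𝔗`) whose image is
`X∖{a}`. -/
def SendsMarkedTo (e : ThetaRing TreeClass → UVQuot)
    (Pat : Struc treeSig) (pt : Pat.carrier) (val : MvPolynomial (Fin 2) ℤ) : Prop :=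
  ∀ (X : Struc treeSig) (hX : X ∈ TreeClass) (a : X.carrier),
    (∃ f : Emb Pat X, f.IsIso ∧ f.toFun pt = a) →
    ∀ (W : Struc treeSig) (hW : W ∈ TreeClass) (g : Emb W X), IsOnePointExt g a →
      e (thetaClass W X hW hX g) = Ideal.Quotient.mk _ val

end Paper

/-! # The measure `μ_τ` on trees -/

namespace Paper

/-- The empty structure. -/
def emptyStruc (σ : Signature) : Struc σ where
  carrier := Empty
  rel := fun _ v => (v ⟨0, σ.arity_pos _⟩).elim

theorem emptyStruc_mem_treeClass : emptyStruc treeSig ∈ TreeClass :=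
  Or.inl (by exact ⟨fun x => x.elim⟩)

/-- The modified falling factorial `[τ]_m = (τ−m+1)(τ−m+2)⋯(τ−2)` as a rational
function (an empty product for `m ≤ 2`). -/
noncomputable def fallingTau (m : ℕ) : RatFunc ℚ :=
  ∏ j ∈ Finset.range (m - 2), (RatFunc.X - ((j : RatFunc ℚ) + 2))

/-- The value `(−1)^{n(T)} · τ · (τ−1)^{−ℓ(T)} · ∏_x [τ]_{v(x)}` of the measure `μ_τ`
on (the leaf structure of) a reduced tree `T`; the product is over the nodes of `T`. -/
noncomputable def treeMuTau (T : FinTree) : RatFunc ℚ :=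
  (-1) ^ T.nNodes * RatFunc.X * ((RatFunc.X - 1)⁻¹) ^ T.nLeaves *
    ∏ x ∈ T.nodeFinset, fallingTau (T.G.degree x)

end Paper

/-! # Quartet systems -/

namespace Paper

/-- The laws of a quartet system: `Q a b c d` says that some split separates `{a, b}` from
`{c, d}`. Degenerate quartets with `a = b` or `c = d` are allowed. -/
structure IsQuartetSystem {α : Type*} (Q : α → α → α → α → Prop) : Prop where
  swap : ∀ {a b c d}, Q a b c d → Q b a c d
  flip : ∀ {a b c d}, Q a b c d → Q c d a b
  subst : ∀ {a b c d} (e), Q a b c d → Q a e c d ∨ Q a b c e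
  trans : ∀ {a b c d e}, Q a b c d → Q a b c e → Q a b d e
  excl : ∀ {a b c d}, Q a b c d → ¬ Q a c b d
  ne : ∀ {a b c d}, Q a b c d → a ≠ c
  diag : ∀ {a c d}, a ≠ c → a ≠ d → Q a a c d

namespace IsQuartetSystem

variable {α β : Type*} {Q Q₁ Q₂ : α → α → α → α → Prop}

theorem swap' (h : IsQuartetSystem Q) {a b c d : α} (hq : Q a b c d) : Q a b d c :=
  h.flip (h.swap (h.flip hq))

theorem comap {Q : β → β → β → β → Prop} (h : IsQuartetSystem Q) {f : α → β}
    (hf : Function.Injective f) :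
    IsQuartetSystem fun a b c d => Q (f a) (f b) (f c) (f d) where
  swap := h.swap
  flip := h.flip
  subst e := h.subst (f e)
  trans := h.trans
  excl := h.excl
  ne hq e := h.ne hq (congrArg f e)
  diag h₁ h₂ := h.diag (hf.ne h₁) (hf.ne h₂)

theorem trans_left (h : IsQuartetSystem Q) {a b c d e : α} (h₁ : Q a b c d) (h₂ : Q a e c d) :
    Q b e c d :=
  h.flip (h.trans (h.flip h₁) (h.flip h₂))

/-- If `a` is attached on the `c`-side of the tripod `q, r, c` and `p` is not, then some split
separates `{a, c}` from `{p, q}`. -/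
theorem split_of_attach (h : IsQuartetSystem Q) {a p q r c : α} (h₁ : Q q r a c)
    (h₂ : ¬ Q q r p c) : Q a c p q := by
  rcases h.subst p h₁ with h₃ | h₃
  · exact h.flip (h.swap h₃)
  · exact absurd (h.swap' (h.trans h₁ h₃)) h₂

/-- Agreement of two quartet systems on all quartets not containing both `a` and `p`. -/
def AgreeOff (Q₁ Q₂ : α → α → α → α → Prop) (a p : α) : Prop :=
  ∀ w x y z, (w ≠ a ∧ x ≠ a ∧ y ≠ a ∧ z ≠ a) ∨ (w ≠ p ∧ x ≠ p ∧ y ≠ p ∧ z ≠ p) →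
    (Q₁ w x y z ↔ Q₂ w x y z)

theorem AgreeOff.symm {a p : α} (h : AgreeOff Q₁ Q₂ a p) : AgreeOff Q₂ Q₁ a p :=
  fun w x y z hn => (h w x y z hn).symm

theorem AgreeOff.comm {a p : α} (h : AgreeOff Q₁ Q₂ a p) : AgreeOff Q₁ Q₂ p a :=
  fun w x y z hn => h w x y z hn.symm

/-- Quartets `ap|yz` are determined by the quartets not containing both `a` and `p`. -/
theorem transfer_same (h₁ : IsQuartetSystem Q₁) (h₂ : IsQuartetSystem Q₂) {a p c q : α}
    (hag : AgreeOff Q₁ Q₂ a p)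
    (hca : c ≠ a) (hcp : c ≠ p) (hqa : q ≠ a) (hqp : q ≠ p) (hap : a ≠ p)
    (hs : Q₁ a c p q) {y z : α} (h : Q₁ a p y z) : Q₂ a p y z := by
  have hya : y ≠ a := (h₁.ne h).symm
  have hza : z ≠ a := (h₁.ne (h₁.swap' h)).symm
  have hyp : y ≠ p := (h₁.ne (h₁.swap h)).symm
  have hzp : z ≠ p := (h₁.ne (h₁.swap (h₁.swap' h))).symm
  have left : Q₁ y z a c → Q₂ a p y z := fun k => by
    have k₁ : Q₁ y z p c := h₁.trans (h₁.flip h) k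
    have k₂ := (hag y z p c (Or.inl ⟨hya, hza, hap.symm, hca⟩)).1 k₁
    have k₃ := (hag y z a c (Or.inr ⟨hyp, hzp, hap, hcp⟩)).1 k
    exact h₂.flip (h₂.trans (h₂.swap' k₃) (h₂.swap' k₂))
  have right : Q₁ y z p q → Q₂ a p y z := fun k => by
    have k₁ : Q₁ y z a q := h₁.trans (h₁.swap' (h₁.flip h)) k
    have k₂ := (hag y z a q (Or.inr ⟨hyp, hzp, hap, hqp⟩)).1 k₁
    have k₃ := (hag y z p q (Or.inl ⟨hya, hza, hap.symm, hqa⟩)).1 k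
    exact h₂.flip (h₂.trans (h₂.swap' k₂) (h₂.swap' k₃))
  rcases h₁.subst y hs with hy | hy
  · rcases h₁.subst z hy with hz | hz
    · exact right (h₁.trans_left hy hz)
    · exact absurd hz (h₁.excl h)
  · rcases h₁.subst z hs with hz | hz
    · rcases h₁.subst y hz with hy' | hy'
      · exact right (h₁.trans_left hy' hz)
      · exact absurd hy' (h₁.excl (h₁.swap' h))
    · exact left (h₁.flip (h₁.trans hy hz))

/-- Quartets `ay|pz` are determined by the quartets not containing both `a` and `p`. -/
theorem transfer_opp (h₁ : IsQuartetSystem Q₁) (h₂ : IsQuartetSystem Q₂) {a p c q : α}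
    (hag : AgreeOff Q₁ Q₂ a p)
    (hca : c ≠ a) (hcp : c ≠ p) (hqa : q ≠ a) (hqp : q ≠ p) (hap : a ≠ p)
    (hs : Q₁ a c p q) (hs₂ : Q₂ a c p q) {y z : α} (h : Q₁ a y p z) : Q₂ a y p z := by
  have hza : z ≠ a := (h₁.ne (h₁.swap' h)).symm
  have hyp : y ≠ p := h₁.ne (h₁.swap h)
  rcases eq_or_ne y a with rfl | hya
  · exact h₂.diag hap hza.symm
  rcases eq_or_ne z p with rfl | hzp
  · exact h₂.flip (h₂.diag hap.symm hyp.symm)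
  have left : Q₁ a y p q → Q₂ a y p z := fun k => by
    have k₁ := (hag a y z q (Or.inr ⟨hap, hyp, hzp, hqp⟩)).1 (h₁.trans h k)
    have k₂ := (hag y c p q (Or.inl ⟨hya, hca, hap.symm, hqa⟩)).1 (h₁.trans_left k hs)
    have k₃ : Q₂ a y p q :=
      h₂.swap (h₂.trans_left (h₂.swap k₂) (h₂.swap hs₂))
    exact h₂.trans (h₂.swap' k₃) (h₂.swap' k₁)
  have right : Q₁ a c p z → Q₂ a y p z := fun k => by
    have k₁ := (hag y c p z (Or.inl ⟨hya, hca, hap.symm, hza⟩)).1 (h₁.trans_left h k)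
    have k₂ := (hag a c q z (Or.inr ⟨hap, hcp, hqp, hzp⟩)).1 (h₁.trans hs k)
    have k₃ : Q₂ a c p z := h₂.trans (h₂.swap' hs₂) k₂
    exact h₂.trans_left (h₂.swap k₃) (h₂.swap k₁)
  rcases h₁.subst y hs with hy | hy
  · exact left hy
  rcases h₁.subst z hs with hz | hz
  · rcases h₁.subst y hz with hy' | hy'
    · exact left hy'
    · exact absurd (h₁.swap' hy') (h₁.excl (h₁.swap' h))
  · exact right hz

/-- If some tripod `q, r, c` distinguishes the places where `a` and `p` are attached, then a
quartet system is determined by the quartets not containing both `a` and `p`. -/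
theorem eq_of_agreeOff (h₁ : IsQuartetSystem Q₁) (h₂ : IsQuartetSystem Q₂) {a p q r c : α}
    (hag : AgreeOff Q₁ Q₂ a p) (hca : c ≠ a) (hcp : c ≠ p) (hqa : q ≠ a) (hqp : q ≠ p)
    (hra : r ≠ a) (hrp : r ≠ p) (hap : a ≠ p)
    (hq : Q₁ q r a c) (hn : ¬ Q₁ q r p c) (w x y z : α) : Q₁ w x y z ↔ Q₂ w x y z := by
  have hs₁ := h₁.split_of_attach hq hn
  have hs₂ := h₂.split_of_attach ((hag q r a c (Or.inr ⟨hqp, hrp, hap, hcp⟩)).1 hq)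
    (fun k => hn ((hag q r p c (Or.inl ⟨hqa, hra, hap.symm, hca⟩)).2 k))
  have hsame : ∀ y z, Q₁ a p y z ↔ Q₂ a p y z := fun y z =>
    ⟨h₁.transfer_same h₂ hag hca hcp hqa hqp hap hs₁,
      h₂.transfer_same h₁ hag.symm hca hcp hqa hqp hap hs₂⟩
  have hopp : ∀ y z, Q₁ a y p z ↔ Q₂ a y p z := fun y z =>
    ⟨h₁.transfer_opp h₂ hag hca hcp hqa hqp hap hs₁ hs₂,
      h₂.transfer_opp h₁ hag.symm hca hcp hqa hqp hap hs₂ hs₁⟩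
  have sw : ∀ {Q : α → α → α → α → Prop}, IsQuartetSystem Q → ∀ a b c d,
      (Q a b c d ↔ Q b a c d) ∧ (Q a b c d ↔ Q a b d c) ∧ (Q a b c d ↔ Q c d a b) :=
    fun h a b c d => ⟨⟨h.swap, h.swap⟩, ⟨h.swap', h.swap'⟩, ⟨h.flip, h.flip⟩⟩
  have key : ∀ x y z, Q₁ a x y z ↔ Q₂ a x y z := by
    intro x y z
    by_cases hx : x = p
    · subst hx; exact hsame y z
    by_cases hy : y = p
    · subst hy; exact hopp x z
    by_cases hz : z = p
    · subst hz
      rw [(sw h₁ a x y z).2.1, (sw h₂ a x y z).2.1]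
      exact hopp x y
    exact hag _ _ _ _ (Or.inr ⟨hap, hx, hy, hz⟩)
  by_cases hw : w = a
  · subst hw; exact key x y z
  by_cases hx : x = a
  · subst hx
    rw [(sw h₁ w x y z).1, (sw h₂ w x y z).1]
    exact key w y z
  by_cases hy : y = a
  · subst hy
    rw [(sw h₁ w x y z).2.2, (sw h₂ w x y z).2.2]
    exact key z w x
  by_cases hz : z = a
  · subst hz
    rw [(sw h₁ w x y z).2.1, (sw h₂ w x y z).2.1, (sw h₁ w x z y).2.2, (sw h₂ w x z y).2.2]
    exact key y w x
  exact hag _ _ _ _ (Or.inl ⟨hw, hx, hy, hz⟩)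

end IsQuartetSystem
end Paper

/-! # Quartet structures and classes of one-point extensions -/

namespace Paper

/-- The quaternary relation of a structure, in curried form. -/
def Struc.R4 (X : Struc treeSig) (a b c d : X.carrier) : Prop := X.rel () ![a, b, c, d]

theorem Struc.rel_iff_R4 (X : Struc treeSig) (i : treeSig.I) (v : Fin 4 → X.carrier) :
    X.rel i v ↔ X.R4 (v 0) (v 1) (v 2) (v 3) := by
  have : v = ![v 0, v 1, v 2, v 3] := by
    funext j; fin_cases j <;> rfl
  exact iff_of_eq (congrArg (X.rel i) this)

/-- The quartet relation `ab|cd`, with its degenerate cases, expressed by the relation of `X`. -/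
def Struc.Quart (X : Struc treeSig) (a b c d : X.carrier) : Prop :=
  (a ≠ c ∧ a ≠ d ∧ b ≠ c ∧ b ≠ d) ∧ (a = b ∨ c = d ∨ (X.R4 a c b d ∧ X.R4 a d b c))

/-- A structure whose relation comes from a quartet system. -/
structure IsQuartetStruc (X : Struc treeSig) : Prop where
  sys : IsQuartetSystem X.Quart
  rel : ∀ a b c d, X.R4 a b c d ↔ (a ≠ b ∧ a ≠ c ∧ a ≠ d ∧ b ≠ c ∧ b ≠ d ∧ c ≠ d) ∧
     (X.Quart a c b d ∨ X.Quart a d b c)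

variable {X Y Z : Struc treeSig}

theorem Emb.R4_iff (f : Emb X Y) (a b c d : X.carrier) :
    Y.R4 (f.toFun a) (f.toFun b) (f.toFun c) (f.toFun d) ↔ X.R4 a b c d := by
  have h := f.rel_iff () ![a, b, c, d]
  rw [Y.rel_iff_R4] at h
  exact h

theorem Emb.quart_iff (f : Emb X Y) (a b c d : X.carrier) :
    Y.Quart (f.toFun a) (f.toFun b) (f.toFun c) (f.toFun d) ↔ X.Quart a b c d := by
  simp only [Struc.Quart, f.R4_iff, f.inj.eq_iff, ne_eq]

theorem IsQuartetStruc.of_emb (h : IsQuartetStruc Y) (f : Emb X Y) : IsQuartetStruc X where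
  sys := by
    have := h.sys.comap f.inj
    simpa only [f.quart_iff] using this
  rel a b c d := by
    have := h.rel (f.toFun a) (f.toFun b) (f.toFun c) (f.toFun d)
    simpa only [f.quart_iff, f.R4_iff, ne_eq, f.inj.eq_iff] using this

theorem Emb.ext_toFun {σ : Signature} {X Y : Struc σ} {f g : Emb X Y}
    (h : ∀ x, f.toFun x = g.toFun x) : f = g := by
  obtain ⟨f, _, _⟩ := f
  obtain ⟨g, _, _⟩ := g
  obtain rfl : f = g := funext h
  rfl

/-- An isomorphism has an inverse. -/
theorem Emb.IsIso.exists_inv {σ : Signature} {X Y : Struc σ} {f : Emb X Y} (hf : f.IsIso) :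
    ∃ g : Emb Y X, g.IsIso ∧ (∀ x, g.toFun (f.toFun x) = x) ∧ ∀ y, f.toFun (g.toFun y) = y := by
  let e := Equiv.ofBijective f.toFun ⟨f.inj, hf⟩
  have hl : ∀ x, e.symm (f.toFun x) = x := e.symm_apply_apply
  have hr : ∀ y, f.toFun (e.symm y) = y := e.apply_symm_apply
  refine ⟨⟨e.symm, e.symm.injective, fun i v => ?_⟩, e.symm.surjective, hl, hr⟩
  rw [← f.rel_iff]
  simp only [hr]

theorem StrucIso.symm {σ : Signature} {X Y : Struc σ} (h : StrucIso X Y) : StrucIso Y X := by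
  obtain ⟨f, hf⟩ := h
  obtain ⟨g, hg, -⟩ := hf.exists_inv
  exact ⟨g, hg⟩

theorem StrucIso.trans {σ : Signature} {X Y Z : Struc σ} (h : StrucIso X Y) (h' : StrucIso Y Z) :
    StrucIso X Z := by
  obtain ⟨f, hf⟩ := h
  obtain ⟨g, hg⟩ := h'
  exact ⟨g.comp f, hg.comp hf⟩

/-- If some tripod distinguishes the places where `a` and `p` are attached, then every
amalgamation of `X∖{p}` and `X∖{a}` in a class of quartet structures is the canonical one. -/
theorem separated_of_tripod {F : Set (Struc treeSig)} (hF : ∀ X ∈ F, IsQuartetStruc X)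
    (hX : IsQuartetStruc X) {a p q r c : X.carrier} (hpa : p ≠ a)
    (hca : c ≠ a) (hcp : c ≠ p) (hqa : q ≠ a) (hqp : q ≠ p) (hra : r ≠ a) (hrp : r ≠ p)
    (h : ¬ (X.Quart q r a c ↔ X.Quart q r p c)) :
    Separated F X p a hpa := by
  classical
  intro A hA
  obtain ⟨W, hW, k, -⟩ := hA
  have hZ : IsQuartetStruc A.Z := (hF W hW).of_emb k
  let g : X.carrier → A.Z.carrier := fun x =>
    if hx : x = p then A.j₂.toFun ⟨p, hpa⟩ else A.j₁.toFun ⟨x, hx⟩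
  have g₁ : ∀ x (hx : x ≠ p), g x = A.j₁.toFun ⟨x, hx⟩ := fun x hx => dif_neg hx
  have g₂ : ∀ x (hx : x ≠ a), g x = A.j₂.toFun ⟨x, hx⟩ := fun x hx => by
    by_cases hxp : x = p
    · subst hxp; exact dif_pos rfl
    · rw [g₁ x hxp]
      exact A.comm ⟨x, by simp [hx, hxp]⟩
  have q₁ : ∀ x y z w, x ≠ p → y ≠ p → z ≠ p → w ≠ p →
      (A.Z.Quart (g x) (g y) (g z) (g w) ↔ X.Quart x y z w) := fun x y z w hx hy hz hw => by
    rw [g₁ x hx, g₁ y hy, g₁ z hz, g₁ w hw]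
    exact (A.j₁.quart_iff _ _ _ _).trans ((X.subEmb _).quart_iff _ _ _ _).symm
  have q₂ : ∀ x y z w, x ≠ a → y ≠ a → z ≠ a → w ≠ a →
      (A.Z.Quart (g x) (g y) (g z) (g w) ↔ X.Quart x y z w) := fun x y z w hx hy hz hw => by
    rw [g₂ x hx, g₂ y hy, g₂ z hz, g₂ w hw]
    exact (A.j₂.quart_iff _ _ _ _).trans ((X.subEmb _).quart_iff _ _ _ _).symm
  have hne : g p ≠ g a := fun e => h (by
    rw [← q₁ q r a c hqp hrp hpa.symm hcp, ← q₂ q r p c hqa hra hpa hca, e])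
  have hinj : Function.Injective g := by
    intro x y e
    by_cases hxp : x = p
    · by_cases hya : y = a
      · subst hxp hya; exact absurd e hne
      · have hxa : x ≠ a := hxp ▸ hpa
        rw [g₂ x hxa, g₂ y hya] at e
        exact congrArg Subtype.val (A.j₂.inj e)
    · by_cases hyp : y = p
      · by_cases hxa : x = a
        · subst hyp hxa; exact absurd e.symm hne
        · have hya : y ≠ a := hyp ▸ hpa
          rw [g₂ x hxa, g₂ y hya] at e
          exact congrArg Subtype.val (A.j₂.inj e)
      · rw [g₁ x hxp, g₁ y hyp] at e
        exact congrArg Subtype.val (A.j₁.inj e)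
  have hsys := hZ.sys.comap hinj
  have hall : ∀ w x y z, X.Quart w x y z ↔ A.Z.Quart (g w) (g x) (g y) (g z) := by
    have hag : IsQuartetSystem.AgreeOff X.Quart
        (fun w x y z => A.Z.Quart (g w) (g x) (g y) (g z)) a p := by
      rintro w x y z (⟨h₁, h₂, h₃, h₄⟩ | ⟨h₁, h₂, h₃, h₄⟩)
      · exact (q₂ w x y z h₁ h₂ h₃ h₄).symm
      · exact (q₁ w x y z h₁ h₂ h₃ h₄).symm
    by_cases hq : X.Quart q r a c
    · exact hX.sys.eq_of_agreeOff hsys hag hca hcp hqa hqp hra hrp hpa.symm hq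
        (fun k => h ⟨fun _ => k, fun _ => hq⟩)
    · have hq' : X.Quart q r p c := by tauto
      exact hX.sys.eq_of_agreeOff hsys hag.comm hcp hca hqp hqa hrp hra hpa hq' hq
  let G : Emb X A.Z := ⟨g, hinj, fun i v => by
    rw [A.Z.rel_iff_R4, X.rel_iff_R4, hZ.rel, hX.rel]
    simp only [← hall, ne_eq, hinj.eq_iff]⟩
  have hG : G.IsIso := fun z => by
    rcases A.surj z with ⟨x, rfl⟩ | ⟨x, rfl⟩
    · exact ⟨x.1, g₁ x.1 x.2⟩
    · exact ⟨x.1, g₂ x.1 x.2⟩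
  obtain ⟨H, hH, hl, -⟩ := hG.exists_inv
  refine ⟨H, hH, fun y => ?_, fun y => ?_⟩
  · exact (congrArg H.toFun (g₁ y.1 y.2)).symm.trans (hl y.1)
  · exact (congrArg H.toFun (g₂ y.1 y.2)).symm.trans (hl y.1)

section Theta

variable {σ : Signature} {F : Set (Struc σ)}

theorem thetaClass_iso {X Y : Struc σ} (hX : X ∈ F) (hY : Y ∈ F) {f : Emb X Y} (hf : f.IsIso) :
    thetaClass X Y hX hY f = 1 := by
  have := Ideal.Quotient.eq.2 (Ideal.subset_span (s := ThetaRels F)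
    (Or.inl (Or.inl ⟨X, Y, hX, hY, f, hf, rfl⟩)))
  simpa [thetaClass] using this

theorem thetaClass_comp {X Y Z : Struc σ} (hX : X ∈ F) (hY : Y ∈ F) (hZ : Z ∈ F)
    (f : Emb X Y) (g : Emb Y Z) :
    thetaClass X Z hX hZ (g.comp f) = thetaClass Y Z hY hZ g * thetaClass X Y hX hY f := by
  have := Ideal.Quotient.eq.2 (Ideal.subset_span (s := ThetaRels F)
    (Or.inl (Or.inr ⟨X, Y, Z, hX, hY, hZ, f, g, rfl⟩)))
  simpa [thetaClass] using this

/-- The class of a one-point extension only depends on the extended structure and the point. -/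
theorem thetaClass_onePointExt {X W W' : Struc σ} (hX : X ∈ F) (hW : W ∈ F) (hW' : W' ∈ F)
    {a : X.carrier} {f : Emb W X} {g : Emb W' X} (hf : IsOnePointExt f a)
    (hg : IsOnePointExt g a) : thetaClass W X hW hX f = thetaClass W' X hW' hX g := by
  have hmem : ∀ w, f.toFun w ∈ Set.range g.toFun := fun w => by
    rw [hg, ← hf]; exact ⟨w, rfl⟩
  choose k hk using hmem
  let K : Emb W W' := ⟨k, fun x y e => f.inj (by rw [← hk x, ← hk y, e]), fun i v => by
    rw [← g.rel_iff, ← f.rel_iff]; simp only [hk]⟩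
  have hK : K.IsIso := fun w => by
    have : g.toFun w ∈ Set.range f.toFun := by rw [hf, ← hg]; exact ⟨w, rfl⟩
    obtain ⟨x, hx⟩ := this
    exact ⟨x, g.inj ((hk x).trans hx)⟩
  have hc : f = g.comp K := Emb.ext_toFun fun x => (hk x).symm
  rw [hc, thetaClass_comp hW hW' hX, thetaClass_iso hW hW' hK, mul_one]

theorem thetaClass_of_separated {X : Struc σ} (hX : X ∈ F) {a p : X.carrier} (hpa : p ≠ a)
    (h₁ : X.restrict {p, a}ᶜ ∈ F) (h₂ : X.restrict {p}ᶜ ∈ F) (h₃ : X.restrict {a}ᶜ ∈ F)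
    (h : Separated F X p a hpa) :
    thetaClass _ _ h₃ hX (X.subEmb {a}ᶜ) =
      thetaClass _ _ h₁ h₂ (X.inclEmb (pair_compl_subset_left p a)) := by
  have := Ideal.Quotient.eq.2 (Ideal.subset_span (s := ThetaRels F)
    (Or.inr ⟨_, _, _, h₁, h₂, h₃, X.inclEmb (pair_compl_subset_left p a),
      X.inclEmb (pair_compl_subset_right p a), 1, fun _ => canonAmalg X p a hpa, fun _ => hX,
      fun A hA => ⟨0, h A hA⟩, fun _ _ _ => Subsingleton.elim _ _, rfl⟩))
  rw [Fin.sum_univ_one] at this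
  exact this.symm

end Theta

end Paper

/-! # Branchings at a marked point -/

namespace Paper

variable {X Y Z : Struc treeSig}

/-- The map `β` sorts the points `≠ a` of `X` into the branches at the node carrying `a`. -/
structure IsBranching (X : Struc treeSig) (a : X.carrier) {ι : Type*} (β : X.carrier → ι) :
    Prop where
  quart : ∀ {b c d}, b ≠ a → c ≠ a → d ≠ a → β b = β c → β b ≠ β d → X.Quart b c a d
  eq_of_quart : ∀ {b c d}, b ≠ a → c ≠ a → d ≠ a → X.Quart b c a d → β b = β c

theorem IsBranching.comap {ι : Type*} {a : X.carrier} {β : X.carrier → ι}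
    (h : IsBranching X a β) (f : Emb Y X) {a' : Y.carrier} (ha : f.toFun a' = a) :
    IsBranching Y a' (fun y => β (f.toFun y)) := by
  subst ha
  refine ⟨fun hb hc hd e n => ?_, fun hb hc hd q => ?_⟩
  · exact (f.quart_iff _ _ _ _).1 (h.quart (f.inj.ne hb) (f.inj.ne hc) (f.inj.ne hd) e n)
  · exact h.eq_of_quart (f.inj.ne hb) (f.inj.ne hc) (f.inj.ne hd) ((f.quart_iff _ _ _ _).2 q)

/-- The class of every one-point extension isomorphic to `(Pat, pt)` is sent to `c`. -/
def SendsExt {K : Type*} [CommRing K] (φ : ThetaRing TreeClass →+* K)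
    (Pat : Struc treeSig) (pt : Pat.carrier) (c : K) : Prop :=
  ∀ (X : Struc treeSig) (hX : X ∈ TreeClass) (a : X.carrier),
    (∃ f : Emb Pat X, f.IsIso ∧ f.toFun pt = a) →
    ∀ (W : Struc treeSig) (hW : W ∈ TreeClass) (g : Emb W X), IsOnePointExt g a →
      φ (thetaClass W X hW hX g) = c

section Patterns

variable {ι : Type*} {a : X.carrier} {β : X.carrier → ι}

/-- Every branch is cut off by a split. -/
theorem IsBranching.quart_of_mem (h : IsBranching X a β) (hX : IsQuartetStruc X) {i : ι}
    {x y z w : X.carrier} (hx : x ≠ a ∧ β x = i) (hy : y ≠ a ∧ β y = i)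
    (hz : ¬ (z ≠ a ∧ β z = i)) (hw : ¬ (w ≠ a ∧ β w = i)) : X.Quart x y z w := by
  obtain ⟨hxa, rfl⟩ := hx
  have key : ∀ z, ¬ (z ≠ a ∧ β z = β x) → z ≠ a → X.Quart x y a z := fun z hz hza =>
    h.quart hxa hy.1 hza hy.2.symm (fun e => hz ⟨hza, e.symm⟩)
  by_cases hza : z = a
  · by_cases hwa : w = a
    · subst hza hwa
      exact hX.sys.flip (hX.sys.diag hxa.symm hy.1.symm)
    · subst hza; exact key w hw hwa
  · by_cases hwa : w = a
    · subst hwa; exact hX.sys.swap' (key z hz hza)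
    · exact hX.sys.trans (key z hz hza) (key w hw hwa)

theorem IsBranching.not_quart_of_injOn (h : IsBranching X a β) (hX : IsQuartetStruc X)
    (hβ : ∀ x y, x ≠ a → y ≠ a → β x = β y → x = y) {b c d e : X.carrier}
    (hbc : b ≠ c) (hde : d ≠ e) : ¬ X.Quart b c d e := by
  have key : ∀ b c d, b ≠ c → d ≠ a → ¬ X.Quart b c a d := fun b c d hbc hd k => by
    have hb : b ≠ a := hX.sys.ne k
    have hc : c ≠ a := hX.sys.ne (hX.sys.swap k)
    exact hbc (hβ b c hb hc (h.eq_of_quart hb hc hd k))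
  intro k
  by_cases hd : d = a
  · subst hd; exact key b c e hbc hde.symm k
  by_cases hb : b = a
  · subst hb; exact key d e c hde hbc.symm (hX.sys.flip k)
  rcases hX.sys.subst a k with k | k
  · exact key d e b hde hb (hX.sys.swap' (hX.sys.flip k))
  · exact key b c d hbc hd (hX.sys.swap' k)

/-- The quartet relation on `Fin n` given by the split into `s` and its complement. -/
def splitQuart {n : ℕ} (s : Fin n → Prop) (i j k l : Fin n) : Prop :=
  (s i ∧ s j ∧ ¬ s k ∧ ¬ s l) ∨ (¬ s i ∧ ¬ s j ∧ s k ∧ s l)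

instance : DecidablePred ZsideA := fun _ => by unfold ZsideA; infer_instance

instance : DecidablePred ZsideC := fun _ => by unfold ZsideC; infer_instance

instance {n : ℕ} (s : Fin n → Prop) [DecidablePred s] (i j k l : Fin n) :
    Decidable (splitQuart s i j k l) := by
  unfold splitQuart; infer_instance

/-- If the points of `X` are enumerated by `f` and enough splits are known to resolve all
quadruples, then these splits compute the quartet relation. -/
theorem IsQuartetStruc.quart_iff_of_total (hX : IsQuartetStruc X) {n : ℕ} {f : Fin n → X.carrier}
    {P : Fin n → Fin n → Fin n → Fin n → Prop}
    (hP : ∀ i j k l, P i j k l → X.Quart (f i) (f j) (f k) (f l)) {i j k l : Fin n}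
    (ht : P i j k l ∨ P i k j l ∨ P i l j k) :
    X.Quart (f i) (f j) (f k) (f l) ↔ P i j k l := by
  refine ⟨fun h => ?_, hP i j k l⟩
  rcases ht with h' | h' | h'
  · exact h'
  · exact absurd (hP _ _ _ _ h') (hX.sys.excl h)
  · exact absurd (hP _ _ _ _ h') (hX.sys.excl (hX.sys.swap' h))

theorem IsQuartetStruc.R4_iff_of_total (hX : IsQuartetStruc X) {n : ℕ} {f : Fin n → X.carrier}
    (hf : Function.Injective f) {P : Fin n → Fin n → Fin n → Fin n → Prop}
    (hP : ∀ i j k l, P i j k l → X.Quart (f i) (f j) (f k) (f l))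
    (ht : ∀ i j k l, (i ≠ j ∧ i ≠ k ∧ i ≠ l ∧ j ≠ k ∧ j ≠ l ∧ k ≠ l) →
      P i j k l ∨ P i k j l ∨ P i l j k) (i j k l : Fin n) :
    X.R4 (f i) (f j) (f k) (f l) ↔
      (i ≠ j ∧ i ≠ k ∧ i ≠ l ∧ j ≠ k ∧ j ≠ l ∧ k ≠ l) ∧ (P i k j l ∨ P i l j k) := by
  rw [hX.rel]
  simp only [hf.ne_iff]
  refine and_congr_right fun hd => ?_
  rw [hX.quart_iff_of_total hP (ht _ _ _ _ (by tauto)),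
    hX.quart_iff_of_total hP (ht _ _ _ _ (by tauto))]

theorem vec4_injective_iff {α : Type*} (i j k l : α) : Function.Injective ![i, j, k, l] ↔
    (i ≠ j ∧ i ≠ k ∧ i ≠ l ∧ j ≠ k ∧ j ≠ l ∧ k ≠ l) := by
  rw [← List.nodup_ofFn]
  simp [List.ofFn_succ]
  tauto

/-- A branching with two branches of sizes one and two is the marked structure `Y`. -/
theorem IsBranching.exists_Y (h : IsBranching X a β) (hX : IsQuartetStruc X) {b₁ b₂ c : X.carrier}
    (h₁ : b₁ ≠ a) (h₂ : b₂ ≠ a) (hc : c ≠ a) (h₁₂ : b₁ ≠ b₂) (hb : β b₁ = β b₂)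
    (hbc : β c ≠ β b₁) (hs : ∀ x, x = a ∨ x = c ∨ x = b₁ ∨ x = b₂) :
    ∃ f : Emb YStruc X, f.IsIso ∧ f.toFun (0 : Fin 4) = a := by
  let f : Fin 4 → X.carrier := ![a, c, b₁, b₂]
  have hf : Function.Injective f := by
    rw [vec4_injective_iff]
    refine ⟨hc.symm, h₁.symm, h₂.symm, fun e => hbc (by rw [e]), fun e => hbc (by rw [e, hb]), h₁₂⟩
  have hside : ∀ j, (f j ≠ a ∧ β (f j) = β b₁) ↔ ¬ ((j : ℕ) < 2) := by
    intro j
    fin_cases j <;> simp [f, h₁, h₂, hb]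
    exact fun _ => hb ▸ hbc
  let P := splitQuart fun j : Fin 4 => ((j : ℕ) < 2)
  have hP : ∀ i j k l, P i j k l → X.Quart (f i) (f j) (f k) (f l) := by
    rintro i j k l (⟨k₁, k₂, k₃, k₄⟩ | ⟨k₁, k₂, k₃, k₄⟩)
    · exact hX.sys.flip (h.quart_of_mem hX ((hside k).2 k₃) ((hside l).2 k₄)
        (fun t => (hside i).1 t k₁) (fun t => (hside j).1 t k₂))
    · exact h.quart_of_mem hX ((hside i).2 k₁) ((hside j).2 k₂)
        (fun t => (hside k).1 t k₃) (fun t => (hside l).1 t k₄)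
  have ht : ∀ i j k l : Fin 4, (i ≠ j ∧ i ≠ k ∧ i ≠ l ∧ j ≠ k ∧ j ≠ l ∧ k ≠ l) →
      P i j k l ∨ P i k j l ∨ P i l j k := by
    decide
  refine ⟨⟨f, hf, fun i v => ?_⟩, fun x => ?_, rfl⟩
  · refine (X.rel_iff_R4 _ _).trans ((hX.R4_iff_of_total hf hP ht (v 0) (v 1) (v 2) (v 3)).trans
      (Iff.trans ?_ (YStruc.rel_iff_R4 _ _).symm))
    change _ ↔ Function.Injective ![v 0, v 1, v 2, v 3] ∧
      (Fin.val (n := 4) (v 0) < 2 ↔ ¬ Fin.val (n := 4) (v 1) < 2) ∧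
      (Fin.val (n := 4) (v 2) < 2 ↔ ¬ Fin.val (n := 4) (v 3) < 2)
    rw [vec4_injective_iff]
    refine and_congr_right fun _ => ?_
    simp only [P, splitQuart]
    clear ht hP
    tauto
  · rcases hs x with rfl | rfl | rfl | rfl
    · exact ⟨(0 : Fin 4), rfl⟩
    · exact ⟨(1 : Fin 4), rfl⟩
    · exact ⟨(2 : Fin 4), rfl⟩
    · exact ⟨(3 : Fin 4), rfl⟩

/-- A branching with two branches of size two is the marked structure `Z`. -/
theorem IsBranching.exists_Z (h : IsBranching X a β) (hX : IsQuartetStruc X)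
    {b₁ b₂ c₁ c₂ : X.carrier} (hb₁ : b₁ ≠ a) (hb₂ : b₂ ≠ a) (hc₁ : c₁ ≠ a) (hc₂ : c₂ ≠ a)
    (hb₁₂ : b₁ ≠ b₂) (hc₁₂ : c₁ ≠ c₂) (hb : β b₁ = β b₂) (hc : β c₁ = β c₂)
    (hbc : β c₁ ≠ β b₁) (hs : ∀ x, x = a ∨ x = c₁ ∨ x = c₂ ∨ x = b₁ ∨ x = b₂) :
    ∃ f : Emb ZStruc X, f.IsIso ∧ f.toFun (4 : Fin 5) = a := by
  let f : Fin 5 → X.carrier := ![b₁, b₂, c₁, c₂, a]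
  have hsideA : ∀ j, (f j ≠ a ∧ β (f j) = β b₁) ↔ ZsideA j := by
    intro j
    fin_cases j <;> simp [f, ZsideA, hb₁, hb₂, hc₁, hc₂, ← hc, hb] <;> exact hb ▸ hbc
  have hsideC : ∀ j, (f j ≠ a ∧ β (f j) = β c₁) ↔ ZsideC j := by
    intro j
    fin_cases j <;> simp [f, ZsideC, hb₁, hb₂, hc₁, hc₂, ← hc, hbc.symm, ← hb]
  have hf : Function.Injective f := by
    have n : ∀ x y, β x ≠ β y → x ≠ y := fun x y e e' => e (by rw [e'])
    rw [← List.nodup_ofFn]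
    simp [f, List.ofFn_succ, hb₁, hb₂, hc₁, hc₂, hb₁₂, hc₁₂, n b₁ c₁ hbc.symm,
      n b₁ c₂ (hc ▸ hbc.symm), n b₂ c₁ (hb ▸ hbc.symm), n b₂ c₂ (hc ▸ hb ▸ hbc.symm)]
  let P := fun i j k l => splitQuart ZsideA i j k l ∨ splitQuart ZsideC i j k l
  have hP : ∀ i j k l, P i j k l → X.Quart (f i) (f j) (f k) (f l) := by
    have gen : ∀ (s : Fin 5 → Prop) (t : ι), (∀ j, (f j ≠ a ∧ β (f j) = t) ↔ s j) →
        ∀ i j k l, splitQuart s i j k l → X.Quart (f i) (f j) (f k) (f l) := by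
      rintro s t hside i j k l (⟨k₁, k₂, k₃, k₄⟩ | ⟨k₁, k₂, k₃, k₄⟩)
      · exact h.quart_of_mem hX ((hside i).2 k₁) ((hside j).2 k₂)
          (fun t => k₃ ((hside k).1 t)) (fun t => k₄ ((hside l).1 t))
      · exact hX.sys.flip (h.quart_of_mem hX ((hside k).2 k₃) ((hside l).2 k₄)
          (fun t => k₁ ((hside i).1 t)) (fun t => k₂ ((hside j).1 t)))
    rintro i j k l (t | t)
    · exact gen _ _ hsideA i j k l t
    · exact gen _ _ hsideC i j k l t
  have ht : ∀ i j k l : Fin 5, (i ≠ j ∧ i ≠ k ∧ i ≠ l ∧ j ≠ k ∧ j ≠ l ∧ k ≠ l) →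
      P i j k l ∨ P i k j l ∨ P i l j k := by
    decide +kernel
  refine ⟨⟨f, hf, fun i v => ?_⟩, fun x => ?_, rfl⟩
  · refine (X.rel_iff_R4 _ _).trans ((hX.R4_iff_of_total hf hP ht (v 0) (v 1) (v 2) (v 3)).trans
      (Iff.trans ?_ (ZStruc.rel_iff_R4 _ _).symm))
    change _ ↔ Function.Injective ![v 0, v 1, v 2, v 3] ∧
      (((ZsideA (v 0) ↔ ¬ ZsideA (v 1)) ∧ (ZsideA (v 2) ↔ ¬ ZsideA (v 3))) ∨
       ((ZsideC (v 0) ↔ ¬ ZsideC (v 1)) ∧ (ZsideC (v 2) ↔ ¬ ZsideC (v 3))))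
    rw [vec4_injective_iff]
    refine and_congr_right fun _ => ?_
    simp only [P, splitQuart]
    clear ht hP
    generalize ZsideA (v 0) = a₀, ZsideA (v 1) = a₁, ZsideA (v 2) = a₂, ZsideA (v 3) = a₃,
      ZsideC (v 0) = c₀, ZsideC (v 1) = c₁, ZsideC (v 2) = c₂, ZsideC (v 3) = c₃
    by_cases a₀ <;> by_cases a₁ <;> by_cases a₂ <;> by_cases a₃ <;> simp [*] <;>
      by_cases c₀ <;> by_cases c₁ <;> by_cases c₂ <;> by_cases c₃ <;> simp [*]
  · rcases hs x with rfl | rfl | rfl | rfl | rfl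
    · exact ⟨(4 : Fin 5), rfl⟩
    · exact ⟨(2 : Fin 5), rfl⟩
    · exact ⟨(3 : Fin 5), rfl⟩
    · exact ⟨(0 : Fin 5), rfl⟩
    · exact ⟨(1 : Fin 5), rfl⟩

/-- A branching in which every branch is a single point is a marked star. -/
theorem IsBranching.exists_X (h : IsBranching X a β) (hX : IsQuartetStruc X) {m : ℕ}
    (hm : 0 < m) (e : ι ≃ Fin (m - 1))
    (hβ : ∀ x y, x ≠ a → y ≠ a → β x = β y → x = y) (hs : ∀ i, ∃ x, x ≠ a ∧ β x = i) :
    ∃ f : Emb (XmStruc m) X, f.IsIso ∧ f.toFun ⟨0, hm⟩ = a := by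
  classical
  obtain ⟨k, rfl⟩ : ∃ k, m = k + 1 := ⟨m - 1, by omega⟩
  let b : {x // x ≠ a} ≃ ι := Equiv.ofBijective (fun x => β x.1)
    ⟨fun x y he => Subtype.ext (hβ _ _ x.2 y.2 he), fun i => by
      obtain ⟨x, hx, hi⟩ := hs i; exact ⟨⟨x, hx⟩, hi⟩⟩
  let g : Fin (k + 1) ≃ X.carrier :=
    ((finSuccEquiv k).trans (Equiv.optionCongr (b.trans e).symm)).trans (Equiv.optionSubtypeNe a)
  refine ⟨⟨g, g.injective, fun i v => ?_⟩, g.surjective, ?_⟩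
  · rw [X.rel_iff_R4, hX.rel]
    change _ ↔ False
    rw [iff_false]
    rintro ⟨⟨h₀₁, h₀₂, h₀₃, h₁₂, h₁₃, h₂₃⟩, k | k⟩
    · exact h.not_quart_of_injOn hX hβ h₀₂ h₁₃ k
    · exact h.not_quart_of_injOn hX hβ h₀₃ h₁₂ k
  · change g 0 = a
    simp only [g, Equiv.trans_apply, finSuccEquiv_zero]
    rfl

end Patterns
end Paper

namespace Paper

variable {X : Struc treeSig} {ι : Type*} {a : X.carrier} {β : X.carrier → ι}

/-- With at least three branches, a point sharing its branch with another one is separated from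
the marked point. -/
theorem IsBranching.separated_of_branches (h : IsBranching X a β) (hX : X ∈ TreeClass)
    (hF : ∀ X ∈ TreeClass, IsQuartetStruc X) {p q c d : X.carrier} (hp : p ≠ a) (hq : q ≠ a)
    (hc : c ≠ a) (hd : d ≠ a) (hpq : p ≠ q) (hβ : β p = β q) (hcp : β p ≠ β c) (hdp : β p ≠ β d)
    (hcd : β c ≠ β d) : Separated TreeClass X p a hp := by
  have hs := (hF X hX).sys
  have n : ∀ {x y}, β x ≠ β y → y ≠ x := fun e e' => e (by rw [e'])
  refine separated_of_tripod hF (hF X hX) hp hq hpq.symm hc (n hcp) hd (n hdp) (fun k => ?_)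
  have h₁ : X.Quart p q c d := hs.trans (h.quart hp hq hc hβ hcp) (h.quart hp hq hd hβ hdp)
  exact hcd (h.eq_of_quart hc hd hq (k.2 (hs.flip h₁)))

/-- Among three points in a branch, one is separated from the marked point. -/
theorem IsBranching.exists_separated (h : IsBranching X a β) (hX : X ∈ TreeClass)
    (hF : ∀ X ∈ TreeClass, IsQuartetStruc X) {p q r c : X.carrier} (hp : p ≠ a) (hq : q ≠ a)
    (hr : r ≠ a) (hc : c ≠ a) (hpq : p ≠ q) (hpr : p ≠ r) (hqr : q ≠ r) (hβq : β p = β q)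
    (hβr : β p = β r) (hβc : β p ≠ β c) :
    ∃ (p q : X.carrier) (hp : p ≠ a), q ≠ a ∧ p ≠ q ∧ β p = β q ∧ Separated TreeClass X p a hp := by
  have hs := (hF X hX).sys
  have n : ∀ {x y}, β x ≠ β y → y ≠ x := fun e e' => e (by rw [e'])
  by_cases hk : X.Quart q r p c
  · refine ⟨q, p, hq, hp, hpq.symm, hβq.symm, separated_of_tripod hF (hF X hX) hq hc
      (n (hβq ▸ hβc)) hp hpq hr hqr.symm fun k => ?_⟩
    exact hs.excl (hs.swap hk) (hs.swap (k.1 (h.quart hp hr hc hβr hβc)))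
  · refine ⟨p, q, hp, hq, hpq, hβq, separated_of_tripod hF (hF X hX) hp hc (n hβc) hq hpq.symm
      hr hpr.symm fun k => hk (k.1 (h.quart hq hr hc (hβq.symm.trans hβr) (hβq ▸ hβc)))⟩

/-- The class of a one-point extension at a point carried by a node with `m - 1` further branches
only depends on `m`. -/
theorem IsBranching.map_thetaClass {K : Type*} [CommRing K] {φ : ThetaRing TreeClass →+* K}
    (hF : ∀ X ∈ TreeClass, IsQuartetStruc X)
    (hsub : ∀ X ∈ TreeClass, ∀ S : Set X.carrier, X.restrict S ∈ TreeClass)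
    [Fintype ι] {m : ℕ} (hm : 3 ≤ m) (hι : Fintype.card ι = m - 1) {c : K}
    (hXm : SendsExt φ (XmStruc m) ⟨0, by omega⟩ c)
    (hY : m = 3 → SendsExt φ YStruc (0 : Fin 4) c) (hZ : m = 3 → SendsExt φ ZStruc (4 : Fin 5) c)
    (h : IsBranching X a β) (hX : X ∈ TreeClass) (hs : ∀ i, ∃ x, x ≠ a ∧ β x = i)
    {W : Struc treeSig} (hW : W ∈ TreeClass) {g : Emb W X} (hg : IsOnePointExt g a) :
    φ (thetaClass W X hW hX g) = c := by
  classical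
  induction hn : Nat.card X.carrier using Nat.strong_induction_on generalizing X W with
  | _ n ih =>
  subst hn
  have step : ∀ (p q : X.carrier) (hp : p ≠ a), q ≠ a → p ≠ q → β p = β q →
      Separated TreeClass X p a hp → φ (thetaClass W X hW hX g) = c := by
    intro p q hp hq hpq hβ hsep
    have h₂ := hsub X hX {p}ᶜ
    rw [thetaClass_onePointExt hX hW (hsub X hX {a}ᶜ) hg
      (show IsOnePointExt (X.subEmb {a}ᶜ) a from Subtype.range_coe),
      thetaClass_of_separated hX hp (hsub X hX _) h₂ (hsub X hX _) hsep]
    refine ih _ ?_ (X := X.restrict {p}ᶜ) (a := ⟨a, hp.symm⟩) (β := fun x => β x.1)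
      (h.comap (X.subEmb {p}ᶜ) rfl) h₂ ?_ (hsub X hX _) ?_ rfl
    · exact Finite.card_subtype_lt (x := p) (by simp)
    · intro i
      obtain ⟨x, hx, hi⟩ := hs i
      by_cases hxp : x = p
      · subst hxp
        exact ⟨⟨q, hpq.symm⟩, fun e => hq (congrArg Subtype.val e), hβ.symm.trans hi⟩
      · exact ⟨⟨x, hxp⟩, fun e => hx (congrArg Subtype.val e), hi⟩
    · ext ⟨x, hx⟩
      constructor
      · rintro ⟨⟨y, hy⟩, e⟩ e'
        have e₁ : y = x := congrArg Subtype.val e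
        have e₂ : x = a := congrArg Subtype.val e'
        exact hy (Or.inr (e₁.trans e₂))
      · intro hxa
        refine ⟨⟨x, ?_⟩, rfl⟩
        rintro (e | e)
        · exact hx e
        · exact hxa (Subtype.ext e)
  by_cases hβ : ∀ x y, x ≠ a → y ≠ a → β x = β y → x = y
  · exact hXm X hX a (h.exists_X (hF X hX) (by omega) (Fintype.equivFinOfCardEq hι) hβ hs) W hW g hg
  push Not at hβ
  obtain ⟨p, q, hp, hq, hpq, hne⟩ := hβ
  rcases hm.lt_or_eq with hm' | rfl
  · have : 2 < (Finset.univ : Finset ι).card := by rw [Finset.card_univ]; omega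
    have : Nontrivial ι := Fintype.one_lt_card_iff_nontrivial.1 (by omega)
    obtain ⟨i, hi⟩ := exists_ne (β p)
    obtain ⟨j, hj⟩ : ∃ j, j ∉ ({β p, i} : Finset ι) := by
      by_contra! hall
      have := Finset.card_le_card (fun j _ => hall j : Finset.univ ⊆ ({β p, i} : Finset ι))
      have := Finset.card_le_two (a := β p) (b := i)
      omega
    simp only [Finset.mem_insert, Finset.mem_singleton, not_or] at hj
    obtain ⟨x, hx, rfl⟩ := hs i
    obtain ⟨y, hy, rfl⟩ := hs j
    exact step p q hp hq hne hpq
      (h.separated_of_branches hX hF hp hq hx hy hne hpq hi.symm (Ne.symm hj.1) (Ne.symm hj.2))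
  have hcard : Fintype.card ι = 2 := hι
  have two : ∀ i j k : ι, i ≠ j → k ≠ j → i = k := by
    intro i j k hi hk
    by_contra hik
    have := Finset.card_le_univ ({i, j, k} : Finset ι)
    rw [Finset.card_eq_three.2 ⟨i, j, k, hi, hik, hk.symm, rfl⟩] at this
    omega
  have : Nontrivial ι := Fintype.one_lt_card_iff_nontrivial.1 (by omega)
  obtain ⟨j, hj⟩ := exists_ne (β p)
  obtain ⟨x, hx, rfl⟩ := hs j
  by_cases hr : ∃ r, r ≠ a ∧ r ≠ p ∧ r ≠ q ∧ β r = β p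
  · obtain ⟨r, hra, hrp, hrq, hr⟩ := hr
    obtain ⟨p', q', hp', hq', hne', hβ', hsep⟩ := h.exists_separated hX hF hp hq hra hx hne
      hrp.symm hrq.symm hpq hr.symm hj.symm
    exact step p' q' hp' hq' hne' hβ' hsep
  push Not at hr
  by_cases hy : ∃ y, y ≠ a ∧ y ≠ x ∧ β y = β x
  · obtain ⟨y, hya, hyx, hy⟩ := hy
    by_cases hz : ∃ z, z ≠ a ∧ z ≠ x ∧ z ≠ y ∧ β z = β x
    · obtain ⟨z, hza, hzx, hzy, hz⟩ := hz
      obtain ⟨p', q', hp', hq', hne', hβ', hsep⟩ := h.exists_separated hX hF hx hya hza hp hyx.symm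
        hzx.symm hzy.symm hy.symm hz.symm hj
      exact step p' q' hp' hq' hne' hβ' hsep
    push Not at hz
    refine hZ rfl X hX a (h.exists_Z (hF X hX) hp hq hx hya hne hyx.symm hpq hy.symm hj
      fun z => ?_) W hW g hg
    by_contra! hall
    exact hz z hall.1 hall.2.1 hall.2.2.1
      (two _ _ _ (hr z hall.1 hall.2.2.2.1 hall.2.2.2.2) hj)
  · push Not at hy
    refine hY rfl X hX a (h.exists_Y (hF X hX) hp hq hx hne hpq hj fun z => ?_) W hW g hg
    by_contra! hall
    exact hy z hall.1 hall.2.1 (two _ _ _ (hr z hall.1 hall.2.2.1 hall.2.2.2) hj)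

end Paper

/-! # Splits of the vertices of a tree by its edges -/

namespace SimpleGraph

variable {V : Type*} {G : SimpleGraph V} {e f : Sym2 V} {a b c d u v x : V}

/-- Two vertices lie on the same side of `e` if they are connected after deleting `e`. -/
def SameSide (G : SimpleGraph V) (e : Sym2 V) (a b : V) : Prop :=
  (G.deleteEdges {e}).Reachable a b

theorem SameSide.refl (a : V) : G.SameSide e a a := Reachable.refl a

theorem SameSide.symm (h : G.SameSide e a b) : G.SameSide e b a := Reachable.symm h

theorem SameSide.trans (h : G.SameSide e a b) (h' : G.SameSide e b c) : G.SameSide e a c :=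
  Reachable.trans h h'

theorem Adj.sameSide (h : G.Adj a b) (he : e ≠ s(a, b)) : G.SameSide e a b := by
  refine Adj.reachable ?_
  rw [deleteEdges_adj]
  exact ⟨h, fun h' => he h'.symm⟩

theorem sameSide_iff_exists_walk : G.SameSide e a b ↔ ∃ p : G.Walk a b, e ∉ p.edges := by
  induction e with
  | _ u v => exact reachable_deleteEdges_iff_exists_walk

theorem IsAcyclic.sameSide_iff (hG : G.IsAcyclic) {p : G.Walk a b} (hp : p.IsPath) :
    G.SameSide e a b ↔ e ∉ p.edges := by
  classical
  rw [sameSide_iff_exists_walk]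
  refine ⟨fun ⟨q, hq⟩ => ?_, fun h => ⟨p, h⟩⟩
  have : p = q.bypass := congrArg Subtype.val
    ((hG.subsingleton_path a b).elim ⟨p, hp⟩ ⟨q.bypass, q.bypass_isPath⟩)
  rw [this]
  exact fun h => hq (q.edges_bypass_subset_edges h)

theorem IsAcyclic.not_sameSide (hG : G.IsAcyclic) (h : G.Adj u v) : ¬ G.SameSide s(u, v) u v := by
  rw [hG.sameSide_iff (p := h.toWalk) (by simp [h.ne])]
  simp

theorem Connected.sameSide_or (hG : G.Connected) (a u v : V) :
    G.SameSide s(u, v) a u ∨ G.SameSide s(u, v) a v := by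
  obtain ⟨p⟩ := hG.preconnected a u
  induction p with
  | nil => exact Or.inl (.refl _)
  | @cons b b' w h _ ih =>
    by_cases he : s(w, v) = s(b, b')
    · rcases Sym2.eq_iff.1 he with ⟨rfl, rfl⟩ | ⟨rfl, rfl⟩
      · exact Or.inl (.refl _)
      · exact Or.inr (.refl _)
    · exact ih.imp (h.sameSide he).trans (h.sameSide he).trans

/-- An edge of a connected graph splits the vertices into at most two sides. -/
theorem Connected.sameSide_of_not (hG : G.Connected) (h : ¬ G.SameSide e a b)
    (h' : ¬ G.SameSide e b c) : G.SameSide e a c := by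
  induction e with
  | _ u v =>
    rcases hG.sameSide_or a u v with ha | ha <;> rcases hG.sameSide_or b u v with hb | hb <;>
      rcases hG.sameSide_or c u v with hc | hc
    all_goals first
      | exact ha.trans hc.symm
      | exact absurd (ha.trans hb.symm) h
      | exact absurd (hb.trans hc.symm) h'

theorem SameSide.of_mem (h : G.SameSide e a b) (h' : ¬ G.SameSide f a b) (hu : u ∈ f) :
    G.SameSide e a u := by
  classical
  obtain ⟨p⟩ := h
  have hf : f ∈ p.edges := by
    by_contra hf
    exact h' (sameSide_iff_exists_walk.2 ⟨p.mapLe (deleteEdges_le _), by simpa using hf⟩)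
  obtain ⟨w, rfl⟩ := hu
  exact ⟨p.takeUntil u (p.fst_mem_support_of_mem_edges hf)⟩

/-- The splits given by two edges are compatible. -/
theorem SameSide.compat (h₁ : G.SameSide e a b) (h₂ : G.SameSide e c d)
    (h₃ : ¬ G.SameSide e a c) (k₁ : G.SameSide f a c) (k₂ : G.SameSide f b d) :
    G.SameSide f a b := by
  by_contra k₃
  have k₄ : ¬ G.SameSide f c d := fun k => k₃ (k₁.trans (k.trans k₂.symm))
  induction f with
  | _ u v =>
    have hu : u ∈ s(u, v) := Sym2.mem_mk_left u v
    exact h₃ ((h₁.of_mem k₃ hu).trans (h₂.of_mem k₄ hu).symm)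

/-- The edge of a leaf cuts it off from all the other vertices. -/
theorem not_sameSide_of_unique (ha : ∀ y, G.Adj a y → y = x) (h : b ≠ a) :
    ¬ G.SameSide s(a, x) a b := by
  rintro ⟨_ | ⟨h', _⟩⟩
  · exact h rfl
  · rw [deleteEdges_adj] at h'
    exact h'.2 (by rw [ha _ h'.1]; rfl)

end SimpleGraph

namespace Paper
open SimpleGraph

/-- A structure whose relation is expressed through a quartet system. -/
theorem isQuartetStruc_of_sys {X : Struc treeSig}
    {Q : X.carrier → X.carrier → X.carrier → X.carrier → Prop} (hQ : IsQuartetSystem Q)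
    (hR : ∀ a b c d, X.R4 a b c d ↔ (a ≠ b ∧ a ≠ c ∧ a ≠ d ∧ b ≠ c ∧ b ≠ d ∧ c ≠ d) ∧
      (Q a c b d ∨ Q a d b c)) :
    IsQuartetStruc X ∧ ∀ a b c d, X.Quart a b c d ↔ Q a b c d := by
  have key : ∀ a b c d, X.Quart a b c d ↔ Q a b c d := by
    intro a b c d
    constructor
    · rintro ⟨⟨h₁, h₂, h₃, h₄⟩, rfl | rfl | ⟨k₁, k₂⟩⟩
      · exact hQ.diag h₁ h₂
      · exact hQ.flip (hQ.diag h₁.symm h₃.symm)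
      · rcases ((hR _ _ _ _).1 k₁).2 with k₁ | k₁
        · exact k₁
        rcases ((hR _ _ _ _).1 k₂).2 with k₂ | k₂
        · exact hQ.swap' k₂
        · exact absurd k₂ (hQ.excl k₁)
    · intro h
      have h₁ := hQ.ne h
      have h₂ := hQ.ne (hQ.swap' h)
      have h₃ := hQ.ne (hQ.swap h)
      have h₄ := hQ.ne (hQ.swap (hQ.swap' h))
      refine ⟨⟨h₁, h₂, h₃, h₄⟩, ?_⟩
      by_cases hab : a = b
      · exact Or.inl hab
      by_cases hcd : c = d
      · exact Or.inr (Or.inl hcd)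
      refine Or.inr (Or.inr ⟨(hR _ _ _ _).2 ⟨⟨h₁, hab, h₂, h₃.symm, hcd, h₄⟩, Or.inl h⟩,
        (hR _ _ _ _).2 ⟨⟨h₂, hab, h₁, h₄.symm, Ne.symm hcd, h₃⟩, Or.inl (hQ.swap' h)⟩⟩)
  have hfun : X.Quart = Q := by
    funext a b c d; exact propext (key a b c d)
  exact ⟨⟨hfun ▸ hQ, by simpa only [hfun] using hR⟩, key⟩

namespace FinTree

variable (T : FinTree)

theorem pathRel_iff {x₁ x₂ y₁ y₂ : T.V} : T.pathRel x₁ x₂ y₁ y₂ ↔ [x₁, x₂, y₁, y₂].Nodup ∧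
    ∃ e, ¬ T.G.SameSide e x₁ x₂ ∧ ¬ T.G.SameSide e y₁ y₂ := by
  refine and_congr_right fun _ => ⟨?_, ?_⟩
  · rintro ⟨p, q, hp, hq, e, h₁, h₂⟩
    refine ⟨e, ?_, ?_⟩
    · rw [T.isTree.isAcyclic.sameSide_iff hp]; exact not_not.2 h₁
    · rw [T.isTree.isAcyclic.sameSide_iff hq]; exact not_not.2 h₂
  · rintro ⟨e, h₁, h₂⟩
    obtain ⟨p, hp⟩ := T.isTree.connected.exists_isPath x₁ x₂
    obtain ⟨q, hq⟩ := T.isTree.connected.exists_isPath y₁ y₂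
    rw [T.isTree.isAcyclic.sameSide_iff hp, not_not] at h₁
    rw [T.isTree.isAcyclic.sameSide_iff hq, not_not] at h₂
    exact ⟨p, q, hp, hq, e, h₁, h₂⟩

theorem exists_unique_neighbor {T : FinTree} {a b : T.V} (ha : T.IsLeaf a) (hb : b ≠ a) :
    ∃ x, T.G.Adj a x ∧ ∀ y, T.G.Adj a y → y = x := by
  have : Nontrivial T.V := ⟨⟨b, a, hb⟩⟩
  have h := T.isTree.connected.preconnected.degree_pos_of_nontrivial a
  have h' : T.G.degree a = 1 := le_antisymm ha h
  exact degree_eq_one_iff_existsUnique_adj.1 h'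

/-- Some edge of `T` splits `a, b` from `c, d`. -/
def Splits (a b c d : T.V) : Prop :=
  ∃ e, T.G.SameSide e a b ∧ T.G.SameSide e c d ∧ ¬ T.G.SameSide e a c

theorem isQuartetSystem_splits :
    IsQuartetSystem fun a b c d : T.leafStruc.carrier => T.Splits a.1 b.1 c.1 d.1 where
  swap := fun ⟨e, h₁, h₂, h₃⟩ => ⟨e, h₁.symm, h₂, fun h => h₃ (h₁.trans h)⟩
  flip := fun ⟨e, h₁, h₂, h₃⟩ => ⟨e, h₂, h₁, fun h => h₃ h.symm⟩
  subst {a b c d} x := fun ⟨e, h₁, h₂, h₃⟩ => by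
    by_cases h : T.G.SameSide e a.1 x.1
    · exact Or.inl ⟨e, h, h₂, h₃⟩
    · exact Or.inr ⟨e, h₁, T.isTree.connected.sameSide_of_not (fun k => h₃ k.symm) h, h₃⟩
  trans := fun {a b c d x} ⟨e, h₁, h₂, h₃⟩ ⟨f, k₁, k₂, k₃⟩ => by
    have hd : ¬ T.G.SameSide e a.1 d.1 := fun h => h₃ (h.trans h₂.symm)
    have hx : ¬ T.G.SameSide f a.1 x.1 := fun h => k₃ (h.trans k₂.symm)
    by_cases h : T.G.SameSide e a.1 x.1
    · by_cases k : T.G.SameSide f a.1 d.1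
      · exact absurd (h.compat h₂.symm hd k k₂.symm) hx
      · exact ⟨f, k₁, T.isTree.connected.sameSide_of_not (fun h => k h.symm) hx, k⟩
    · exact ⟨e, h₁, T.isTree.connected.sameSide_of_not (fun h => hd h.symm) h, hd⟩
  excl := fun ⟨e, h₁, h₂, h₃⟩ ⟨f, k₁, k₂, k₃⟩ => k₃ (h₁.compat h₂ h₃ k₁ k₂)
  ne := fun ⟨e, _, _, h⟩ h' => h (h' ▸ .refl _)
  diag := fun {a c d} hc hd => by
    have hc' : c.1 ≠ a.1 := fun h => hc (Subtype.ext h.symm)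
    have hd' : d.1 ≠ a.1 := fun h => hd (Subtype.ext h.symm)
    obtain ⟨x, -, hu⟩ := exists_unique_neighbor a.2 hc'
    have h₁ := not_sameSide_of_unique hu hc'
    have h₂ := not_sameSide_of_unique hu hd'
    exact ⟨_, .refl _, T.isTree.connected.sameSide_of_not (fun h => h₁ h.symm) h₂, h₁⟩

theorem leafStruc_R4 (a b c d : T.leafStruc.carrier) : T.leafStruc.R4 a b c d ↔
    (a ≠ b ∧ a ≠ c ∧ a ≠ d ∧ b ≠ c ∧ b ≠ d ∧ c ≠ d) ∧
      ∃ e, ¬ T.G.SameSide e a.1 b.1 ∧ ¬ T.G.SameSide e c.1 d.1 := by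
  change T.pathRel a.1 b.1 c.1 d.1 ↔ _
  rw [pathRel_iff]
  refine and_congr_left fun _ => ?_
  have n : ∀ x y : T.leafStruc.carrier, x.1 = y.1 ↔ x = y := fun x y => Subtype.ext_iff.symm
  simp [n, and_assoc]

theorem leafStruc_isQuartetStruc_and : IsQuartetStruc T.leafStruc ∧
    ∀ a b c d, T.leafStruc.Quart a b c d ↔ T.Splits a.1 b.1 c.1 d.1 := by
  refine isQuartetStruc_of_sys T.isQuartetSystem_splits fun a b c d => ?_
  rw [leafStruc_R4]
  refine and_congr_right fun _ => ⟨?_, ?_⟩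
  · rintro ⟨e, h₁, h₂⟩
    have hc := T.isTree.connected
    by_cases h : T.G.SameSide e a.1 c.1
    · have had : ¬ T.G.SameSide e a.1 d.1 := fun h' => h₂ (h.symm.trans h')
      exact Or.inl ⟨e, h, hc.sameSide_of_not (fun k => h₁ k.symm) had, h₁⟩
    · have h' := hc.sameSide_of_not h h₂
      exact Or.inr ⟨e, h', hc.sameSide_of_not (fun k => h₁ k.symm) h, h₁⟩
  · rintro (⟨e, h₁, h₂, h₃⟩ | ⟨e, h₁, h₂, h₃⟩)
    · exact ⟨e, h₃, fun h => h₃ (h₁.trans (h.trans h₂.symm))⟩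
    · exact ⟨e, h₃, fun h => h₃ (h₁.trans (h.symm.trans h₂.symm))⟩

theorem leafStruc_isQuartetStruc : IsQuartetStruc T.leafStruc := T.leafStruc_isQuartetStruc_and.1

theorem leafStruc_quart {a b c d : T.leafStruc.carrier} :
    T.leafStruc.Quart a b c d ↔ T.Splits a.1 b.1 c.1 d.1 :=
  T.leafStruc_isQuartetStruc_and.2 a b c d

end FinTree

theorem isQuartetStruc_of_isEmpty {X : Struc treeSig} [IsEmpty X.carrier] : IsQuartetStruc X where
  sys := by constructor <;> intro a <;> exact isEmptyElim a
  rel a := isEmptyElim a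

theorem isQuartetStruc_of_mem_treeClass : ∀ X ∈ TreeClass, IsQuartetStruc X := by
  rintro X (h | ⟨T, f, -⟩)
  · exact isQuartetStruc_of_isEmpty
  · exact T.leafStruc_isQuartetStruc.of_emb f

end Paper

/-! # Deleting a leaf -/

namespace Paper
open SimpleGraph

theorem mem_treeClass_of_strucIso {X Y : Struc treeSig} (h : StrucIso X Y) (hY : Y ∈ TreeClass) :
    X ∈ TreeClass := by
  rcases hY with hY | ⟨T, hT⟩
  · obtain ⟨f, -⟩ := h
    exact Or.inl (Function.isEmpty f.toFun)
  · exact Or.inr ⟨T, h.trans hT⟩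

theorem restrict_mem_of_onePointExt {W X : Struc treeSig} (hW : W ∈ TreeClass) {a : X.carrier}
    {g : Emb W X} (hg : IsOnePointExt g a) : X.restrict {a}ᶜ ∈ TreeClass := by
  have hr : ∀ w, g.toFun w ∈ ({a}ᶜ : Set X.carrier) := fun w => hg ▸ ⟨w, rfl⟩
  have h : StrucIso W (X.restrict {a}ᶜ) := by
    refine ⟨⟨fun w => ⟨g.toFun w, hr w⟩, fun w w' e => g.inj (congrArg Subtype.val e),
      fun i v => g.rel_iff i v⟩, ?_⟩
    rintro ⟨x, hx⟩
    obtain ⟨w, rfl⟩ : x ∈ Set.range g.toFun := hg ▸ hx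
    exact ⟨w, rfl⟩
  exact mem_treeClass_of_strucIso h.symm hW

theorem IsOnePointExt.comp_iso {σ : Signature} {W X Y : Struc σ} {a : X.carrier} {g : Emb W X}
    (hg : IsOnePointExt g a) {f : Emb X Y} (hf : f.IsIso) :
    IsOnePointExt (f.comp g) (f.toFun a) := by
  change Set.range (f.toFun ∘ g.toFun) = _
  rw [Set.range_comp, hg, Set.image_compl_eq ⟨f.inj, hf⟩, Set.image_singleton]

theorem isOnePointExt_subEmb {σ : Signature} (X : Struc σ) (a : X.carrier) :
    IsOnePointExt (X.subEmb {a}ᶜ) a := Subtype.range_coe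

namespace FinTree

variable {T T' : FinTree}

theorem pathRel_iff_of_isPath {x₁ x₂ y₁ y₂ : T.V} {p : T.G.Walk x₁ x₂} {q : T.G.Walk y₁ y₂}
    (hp : p.IsPath) (hq : q.IsPath) :
    T.pathRel x₁ x₂ y₁ y₂ ↔ [x₁, x₂, y₁, y₂].Nodup ∧ ∃ e ∈ p.edges, e ∈ q.edges := by
  rw [pathRel_iff]
  simp only [T.isTree.isAcyclic.sameSide_iff hp, T.isTree.isAcyclic.sameSide_iff hq, not_not]

theorem pathRel_map (φ : T'.G →g T.G) (hφ : Function.Injective φ) (x₁ x₂ y₁ y₂ : T'.V) :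
    T.pathRel (φ x₁) (φ x₂) (φ y₁) (φ y₂) ↔ T'.pathRel x₁ x₂ y₁ y₂ := by
  obtain ⟨p, hp⟩ := T'.isTree.connected.exists_isPath x₁ x₂
  obtain ⟨q, hq⟩ := T'.isTree.connected.exists_isPath y₁ y₂
  rw [pathRel_iff_of_isPath hp hq, pathRel_iff_of_isPath (hp.map hφ)
    (hq.map hφ), Walk.edges_map, Walk.edges_map]
  refine and_congr ?_ ⟨?_, ?_⟩
  · exact List.nodup_map_iff (l := [x₁, x₂, y₁, y₂]) hφ
  · rintro ⟨e, h₁, h₂⟩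
    obtain ⟨e₁, k₁, rfl⟩ := List.mem_map.1 h₁
    obtain ⟨e₂, k₂, h⟩ := List.mem_map.1 h₂
    exact ⟨e₁, k₁, Sym2.map.injective hφ h ▸ k₂⟩
  · rintro ⟨e, h₁, h₂⟩
    exact ⟨_, List.mem_map_of_mem h₁, List.mem_map_of_mem h₂⟩

variable (T) in
/-- The tree obtained by deleting a vertex of valence one. -/
def erase (a : T.V) (ha : T.G.degree a = 1) : FinTree where
  V := ({a}ᶜ : Set T.V)
  G := T.G.induce {a}ᶜ
  isTree := ⟨T.isTree.connected.induce_compl_singleton_of_degree_eq_one ha,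
    T.isTree.isAcyclic.comap (Embedding.induce ({a}ᶜ : Set T.V)).toHom Subtype.val_injective⟩

variable {a x : T.V} {ha : T.G.degree a = 1}

theorem pathRel_erase (x₁ x₂ y₁ y₂ : (T.erase a ha).V) :
    T.pathRel x₁.1 x₂.1 y₁.1 y₂.1 ↔ (T.erase a ha).pathRel x₁ x₂ y₁ y₂ :=
  pathRel_map (T' := T.erase a ha) (Embedding.induce ({a}ᶜ : Set T.V)).toHom
    Subtype.val_injective x₁ x₂ y₁ y₂

theorem degree_erase (v : (T.erase a ha).V) :
    (T.erase a ha).G.degree v = ((T.G.neighborFinset v.1).erase a).card := by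
  rw [← card_neighborFinset_eq_degree]
  refine Finset.card_bij (fun w _ => w.1) (fun w hw => ?_) (fun _ _ _ _ h => Subtype.ext h)
    (fun w hw => ?_)
  · rw [mem_neighborFinset] at hw
    exact Finset.mem_erase.2 ⟨w.2, by rw [mem_neighborFinset]; exact hw⟩
  · obtain ⟨h₁, h₂⟩ := Finset.mem_erase.1 hw
    rw [mem_neighborFinset] at h₂
    exact ⟨⟨w, h₁⟩, (mem_neighborFinset _ _ _).2 h₂, rfl⟩

theorem degree_erase_of_not_adj {v : (T.erase a ha).V} (h : ¬ T.G.Adj a v.1) :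
    (T.erase a ha).G.degree v = T.G.degree v.1 := by
  rw [degree_erase, Finset.erase_eq_of_notMem, card_neighborFinset_eq_degree]
  rw [mem_neighborFinset]
  exact fun h' => h h'.symm

theorem degree_erase_of_adj {v : (T.erase a ha).V} (h : T.G.Adj a v.1) :
    (T.erase a ha).G.degree v = T.G.degree v.1 - 1 := by
  rw [degree_erase, Finset.card_erase_of_mem, card_neighborFinset_eq_degree]
  rw [mem_neighborFinset]
  exact h.symm

theorem eq_of_adj (ha : T.G.degree a = 1) (hx : T.G.Adj a x) {y : T.V} (hy : T.G.Adj a y) :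
    y = x := (degree_eq_one_iff_existsUnique_adj.1 ha).unique hy hx

theorem isLeaf_of_degree (ha : T.G.degree a = 1) : T.IsLeaf a := ha.le

/-- Deleting a leaf whose neighbor does not have valence two amounts to deleting a point of the
leaf structure. -/
theorem exists_onePointExt_erase (hx : T.G.Adj a x) (hd : T.G.degree x ≠ 2) :
    ∃ g : Emb (T.erase a ha).leafStruc T.leafStruc, IsOnePointExt g ⟨a, isLeaf_of_degree ha⟩ := by
  have hleaf : ∀ v : (T.erase a ha).V, (T.erase a ha).IsLeaf v ↔ T.IsLeaf v.1 := by
    intro v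
    unfold IsLeaf
    by_cases h : T.G.Adj a v.1
    · rw [degree_erase_of_adj h]
      have := eq_of_adj ha hx h
      rw [this]
      omega
    · rw [degree_erase_of_not_adj h]
  refine ⟨⟨fun v => ⟨v.1.1, (hleaf v.1).1 v.2⟩,
    fun v w h => Subtype.ext (Subtype.ext (Subtype.mk.inj h)),
    fun i v => pathRel_erase _ _ _ _⟩, ?_⟩
  ext ⟨v, hv⟩
  constructor
  · rintro ⟨w, hw⟩ h
    have h₁ : w.1.1 = v := congrArg Subtype.val hw
    have h₂ : v = a := congrArg Subtype.val h
    exact w.1.2 (h₁.trans h₂)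
  · intro h
    have hva : v ≠ a := fun h' => h (Subtype.ext h')
    exact ⟨⟨⟨v, hva⟩, (hleaf ⟨v, hva⟩).2 hv⟩, rfl⟩

theorem sameSide_of_ne (ha : T.G.degree a = 1) (hx : T.G.Adj a x) {v w : T.V} (hv : v ≠ a)
    (hw : w ≠ a) : T.G.SameSide s(a, x) v w := by
  have n := fun b hb => not_sameSide_of_unique (b := b) (fun y => eq_of_adj ha hx (y := y)) hb
  exact T.isTree.connected.sameSide_of_not (fun h => n v hv h.symm) (n w hw)

/-- Deleting a leaf whose neighbor has valence two does not change the leaf structure. -/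
theorem exists_iso_erase (hx : T.G.Adj a x) (hd : T.G.degree x = 2) :
    ∃ g : Emb (T.erase a ha).leafStruc T.leafStruc, g.IsIso := by
  have hxa : x ≠ a := hx.ne'
  have hleaf : ∀ v : (T.erase a ha).V, (T.erase a ha).IsLeaf v ↔ T.IsLeaf v.1 ∨ v.1 = x := by
    intro v
    unfold IsLeaf
    by_cases h : T.G.Adj a v.1
    · rw [degree_erase_of_adj h]
      have := eq_of_adj ha hx h
      rw [this]
      simp [hd]
    · have : v.1 ≠ x := fun h' => h (h' ▸ hx)
      rw [degree_erase_of_not_adj h]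
      simp [this]
  let s : T.V → T.V := fun v => if v = x then a else v
  have hsx : s x = a := if_pos rfl
  have hs : ∀ {v}, v ≠ x → s v = v := fun h => if_neg h
  have hsinj : ∀ {v w}, v ≠ a → w ≠ a → s v = s w → v = w := by
    intro v w hv hw h
    by_cases hvx : v = x <;> by_cases hwx : w = x
    · rw [hvx, hwx]
    · subst hvx; rw [hsx, hs hwx] at h; exact absurd h.symm hw
    · subst hwx; rw [hsx, hs hvx] at h; exact absurd h hv
    · rwa [hs hvx, hs hwx] at h
  have hside : ∀ e, e ≠ s(a, x) → ∀ v, T.G.SameSide e (s v) v := by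
    intro e he v
    by_cases hvx : v = x
    · subst hvx; rw [hsx]; exact hx.sameSide he
    · rw [hs hvx]; exact .refl _
  have hall : ∀ v w, v ≠ a → w ≠ a → T.G.SameSide s(a, x) v w := fun v w =>
    sameSide_of_ne ha hx
  refine ⟨⟨fun v => ⟨s v.1.1, ?_⟩, fun v w h => Subtype.ext (Subtype.ext
    (hsinj v.1.2 w.1.2 (congrArg Subtype.val h))), fun i v => ?_⟩, ?_⟩
  · by_cases h : v.1.1 = x
    · rw [h, hsx]; exact isLeaf_of_degree ha
    · rw [hs h]; exact ((hleaf v.1).1 v.2).resolve_right h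
  · refine Iff.trans ?_ (pathRel_erase _ _ _ _)
    have key : ∀ b c d e : T.V, b ≠ a → c ≠ a → d ≠ a → e ≠ a →
        (T.pathRel (s b) (s c) (s d) (s e) ↔ T.pathRel b c d e) := by
      intro b c d e hb hc hd' he
      rw [pathRel_iff, pathRel_iff]
      have n : ∀ {v w}, v ≠ a → w ≠ a → (s v = s w ↔ v = w) := fun hv hw =>
        ⟨hsinj hv hw, fun h => h ▸ rfl⟩
      have hnd : [s b, s c, s d, s e].Nodup ↔ [b, c, d, e].Nodup := by
        simp [n hb hc, n hb hd', n hb he, n hc hd', n hc he, n hd' he]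
      rw [hnd]
      refine and_congr_right fun hn => exists_congr fun f => ?_
      have hn' : (b ≠ c ∧ b ≠ d ∧ b ≠ e) ∧ (c ≠ d ∧ c ≠ e) ∧ d ≠ e := by simpa using hn
      by_cases hf : f = s(a, x)
      · subst hf
        refine iff_of_false (fun h => ?_) (fun h => h.1 (hall b c hb hc))
        have hsa : ∀ v, v ≠ a → v ≠ x → s v ≠ a := fun v hv hvx => by rwa [hs hvx]
        have hde : d ≠ x → e ≠ x → False := fun h₁ h₂ =>
          h.2 (hall _ _ (hsa d hd' h₁) (hsa e he h₂))
        by_cases hbx : b = x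
        · exact hde (hbx ▸ hn'.1.2.1.symm) (hbx ▸ hn'.1.2.2.symm)
        · by_cases hcx : c = x
          · exact hde (hcx ▸ hn'.2.1.1.symm) (hcx ▸ hn'.2.1.2.symm)
          · exact h.1 (hall _ _ (hsa b hb hbx) (hsa c hc hcx))
      · have n : ∀ v w, T.G.SameSide f (s v) (s w) ↔ T.G.SameSide f v w := fun v w =>
          ⟨fun h => (hside f hf v).symm.trans (h.trans (hside f hf w)),
            fun h => (hside f hf v).trans (h.trans (hside f hf w).symm)⟩
        rw [n, n]
    exact key _ _ _ _ (v 0).1.2 (v 1).1.2 (v 2).1.2 (v 3).1.2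
  · rintro ⟨v, hv⟩
    by_cases hva : v = a
    · subst hva
      exact ⟨⟨⟨x, hxa⟩, (hleaf ⟨x, hxa⟩).2 (Or.inr rfl)⟩, Subtype.ext hsx⟩
    · have hvx : v ≠ x := by
        rintro rfl
        unfold IsLeaf at hv
        omega
      exact ⟨⟨⟨v, hva⟩, (hleaf ⟨v, hva⟩).2 (Or.inl hv)⟩, Subtype.ext (hs hvx)⟩

theorem card_erase_lt : Fintype.card (T.erase a ha).V < Fintype.card T.V :=
  Fintype.card_subtype_lt (x := a) (by simp)

end FinTree

theorem leafStruc_restrict_mem (T : FinTree) (a : T.leafStruc.carrier) :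
    T.leafStruc.restrict {a}ᶜ ∈ TreeClass := by
  induction hn : Fintype.card T.V using Nat.strong_induction_on generalizing T with
  | _ n ih =>
  subst hn
  obtain ⟨a, hla⟩ := a
  rcases subsingleton_or_nontrivial T.V with hV | hV
  · exact Or.inl ⟨fun b => b.2 (Subtype.ext (Subsingleton.elim _ _))⟩
  have ha : T.G.degree a = 1 :=
    le_antisymm hla (T.isTree.connected.preconnected.degree_pos_of_nontrivial a)
  obtain ⟨x, hx, -⟩ := degree_eq_one_iff_existsUnique_adj.1 ha
  by_cases hd : T.G.degree x = 2
  · obtain ⟨g, hg⟩ := FinTree.exists_iso_erase (ha := ha) hx hd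
    obtain ⟨b, hb⟩ := hg ⟨a, hla⟩
    have := ih _ FinTree.card_erase_lt (T.erase a ha) b rfl
    rw [← hb]
    exact restrict_mem_of_onePointExt this ((isOnePointExt_subEmb _ b).comp_iso hg)
  · obtain ⟨g, hg⟩ := FinTree.exists_onePointExt_erase (ha := ha) hx hd
    exact restrict_mem_of_onePointExt (leafStruc_mem_treeClass _) hg

/-- The class of tree structures is hereditary. -/
theorem restrict_mem_treeClass : ∀ X ∈ TreeClass, ∀ S : Set X.carrier,
    X.restrict S ∈ TreeClass := by
  intro X hX S
  induction hn : Nat.card X.carrier using Nat.strong_induction_on generalizing X with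
  | _ n ih =>
  subst hn
  by_cases hS : ∀ a, a ∈ S
  · exact mem_treeClass_of_strucIso ⟨X.subEmb S, fun a => ⟨⟨a, hS a⟩, rfl⟩⟩ hX
  push Not at hS
  obtain ⟨a, ha⟩ := hS
  have h₁ : X.restrict {a}ᶜ ∈ TreeClass := by
    rcases hX with hX | ⟨T, f, hf⟩
    · exact Or.inl ⟨fun x => hX.elim x.1⟩
    · obtain ⟨g, hg, h, -⟩ := hf.exists_inv
      have := restrict_mem_of_onePointExt (leafStruc_restrict_mem T (f.toFun a))
        ((isOnePointExt_subEmb _ _).comp_iso hg)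
      rwa [h] at this
  have h₂ := ih _ (Finite.card_subtype_lt (x := a) (by simp)) (X.restrict {a}ᶜ) h₁
    (Subtype.val ⁻¹' S) rfl
  have h₃ : StrucIso ((X.restrict {a}ᶜ).restrict (Subtype.val ⁻¹' S)) (X.restrict S) := by
    refine ⟨⟨fun x => ⟨x.1.1, x.2⟩, fun x y h => Subtype.ext (Subtype.ext (Subtype.mk.inj h)),
      fun i v => Iff.rfl⟩, ?_⟩
    rintro ⟨x, hx⟩
    exact ⟨⟨⟨x, fun h => ha ((show x = a from h) ▸ hx)⟩, hx⟩, rfl⟩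
  exact mem_treeClass_of_strucIso h₃.symm h₂

end Paper

/-! # The branches of a tree at the neighbor of a leaf -/

namespace Paper
open SimpleGraph
namespace FinTree

variable {T : FinTree} {a x y y' d : T.V}

/-- A vertex lies beyond at most one of the edges at `x`. -/
theorem eq_of_not_sameSide (hy : T.G.Adj x y) (hy' : T.G.Adj x y')
    (h : ¬ T.G.SameSide s(x, y) d x) (h' : ¬ T.G.SameSide s(x, y') d x) : y = y' := by
  by_contra hne
  have hc := T.isTree.connected
  have hac := T.isTree.isAcyclic
  have he : s(x, y) ≠ s(x, y') := fun e => hne (Sym2.congr_right.1 e)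
  have h₁ := hc.sameSide_of_not h (hac.not_sameSide hy)
  have h₂ := hc.sameSide_of_not h' (hac.not_sameSide hy')
  have h₃ := (hy'.sameSide he).symm
  have h₄ := (hy.sameSide he.symm).symm
  exact h' ((h₁.compat h₃ (fun k => h (k.trans h₃)) h₂ h₄).trans h₄)

theorem exists_adj_not_sameSide (h : d ≠ x) :
    ∃ y, T.G.Adj x y ∧ ¬ T.G.SameSide s(x, y) d x := by
  obtain ⟨p, hp⟩ := T.isTree.connected.exists_isPath x d
  cases p with
  | nil => exact absurd rfl h
  | @cons _ y _ hy q =>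
    refine ⟨y, hy, fun k => ?_⟩
    exact (T.isTree.isAcyclic.sameSide_iff hp).1 k.symm (by simp)

/-- There is a leaf beyond every edge. -/
theorem exists_isLeaf_not_sameSide {u v : T.V} (h : T.G.Adj u v) :
    ∃ w, T.IsLeaf w ∧ ¬ T.G.SameSide s(u, v) w u := by
  classical
  have hac := T.isTree.isAcyclic
  induction hn : (Finset.univ.filter fun w => ¬ T.G.SameSide s(u, v) w u).card using
    Nat.strong_induction_on generalizing u v with
  | _ n ih =>
  subst hn
  have hv : ¬ T.G.SameSide s(u, v) v u := fun k => hac.not_sameSide h k.symm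
  by_cases hl : T.IsLeaf v
  · exact ⟨v, hl, hv⟩
  obtain ⟨v', hv', hne⟩ : ∃ v', T.G.Adj v v' ∧ v' ≠ u := by
    by_contra! hall
    refine hl ?_
    rw [IsLeaf, ← card_neighborFinset_eq_degree]
    refine Finset.card_le_one.2 fun y hy z hz => ?_
    rw [mem_neighborFinset] at hy hz
    rw [hall y hy, hall z hz]
  have hsub : ∀ w, ¬ T.G.SameSide s(v, v') w v → ¬ T.G.SameSide s(u, v) w u := by
    intro w hw k
    have : T.G.SameSide s(v, u) w v := by
      by_contra hw'
      exact hne (eq_of_not_sameSide h.symm hv' hw' hw).symm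
    rw [Sym2.eq_swap] at this
    exact hac.not_sameSide h (k.symm.trans this)
  obtain ⟨w, hw, hw'⟩ := ih _ (Finset.card_lt_card ⟨fun w => by simpa using hsub w, fun k => by
    have := k (Finset.mem_filter.2 ⟨Finset.mem_univ v, hv⟩)
    exact (Finset.mem_filter.1 this).2 (.refl _)⟩) hv' rfl
  exact ⟨w, hw, hsub w hw'⟩

/-- The leaves other than `a` are sorted into branches by the neighbors other than `a` of the node
carrying `a`. -/
theorem exists_isBranching (ha : T.G.degree a = 1) (hx : T.G.Adj a x) (hd : 3 ≤ T.G.degree x) :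
    ∃ β : T.leafStruc.carrier → {y // y ∈ (T.G.neighborFinset x).erase a},
      IsBranching T.leafStruc ⟨a, isLeaf_of_degree ha⟩ β ∧
      ∀ i, ∃ b : T.leafStruc.carrier, b ≠ ⟨a, isLeaf_of_degree ha⟩ ∧ β b = i := by
  classical
  have hc := T.isTree.connected
  have hex : ∀ b : T.leafStruc.carrier, ∃ y : {y // y ∈ (T.G.neighborFinset x).erase a},
      b.1 ≠ a → ¬ T.G.SameSide s(x, y.1) b.1 x := by
    intro b
    by_cases hb : b.1 = a
    · have : 0 < ((T.G.neighborFinset x).erase a).card := by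
        rw [Finset.card_erase_of_mem (by simpa using hx.symm), card_neighborFinset_eq_degree]
        omega
      obtain ⟨y, hy⟩ := Finset.card_pos.1 this
      exact ⟨⟨y, hy⟩, fun h => absurd hb h⟩
    · have hbx : b.1 ≠ x := by
        intro h
        have := b.2
        rw [h, IsLeaf] at this
        omega
      obtain ⟨y, hy, hs⟩ := exists_adj_not_sameSide hbx
      refine ⟨⟨y, Finset.mem_erase.2 ⟨?_, by simpa using hy⟩⟩, fun _ => hs⟩
      rintro rfl
      rw [Sym2.eq_swap] at hs
      exact hs (sameSide_of_ne ha hx hb hx.ne')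
  choose β hβ using hex
  have hadj : ∀ y : {y // y ∈ (T.G.neighborFinset x).erase a}, T.G.Adj x y.1 := fun y => by
    simpa using Finset.mem_of_mem_erase y.2
  have hax : ∀ y : {y // y ∈ (T.G.neighborFinset x).erase a},
      T.G.SameSide s(x, y.1) a x := fun y => by
    refine hx.sameSide fun e => Finset.ne_of_mem_erase y.2 ?_
    rw [Sym2.eq_swap (a := a)] at e
    exact Sym2.congr_right.1 e
  have hn : ∀ {b : T.leafStruc.carrier}, b ≠ ⟨a, isLeaf_of_degree ha⟩ → b.1 ≠ a :=
    fun h h' => h (Subtype.ext h')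
  have huniq : ∀ (b : T.leafStruc.carrier) (y : {y // y ∈ (T.G.neighborFinset x).erase a}),
      b.1 ≠ a → ¬ T.G.SameSide s(x, y.1) b.1 x → β b = y := fun b y hb h =>
    Subtype.ext (eq_of_not_sameSide (hadj _) (hadj _) (hβ b hb) h)
  refine ⟨β, ⟨?_, ?_⟩, fun y => ?_⟩
  · intro b c d hb hc' hd' hbc hbd
    refine T.leafStruc_quart.2 ?_
    have h₁ := hβ b (hn hb)
    have h₂ := hβ c (hn hc')
    rw [← hbc] at h₂
    have h₃ : T.G.SameSide s(x, (β b).1) d.1 x := by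
      by_contra h
      exact hbd (huniq d _ (hn hd') h).symm
    exact ⟨s(x, (β b).1), hc.sameSide_of_not h₁ (fun k => h₂ k.symm), (hax _).trans h₃.symm,
      fun k => h₁ (k.trans (hax _))⟩
  · intro b c d hb hc' hd' hq
    obtain ⟨f, h₁, h₂, h₃⟩ := T.leafStruc_quart.1 hq
    by_contra hne
    have k₁ := hβ b (hn hb)
    have k₂ : T.G.SameSide s(x, (β b).1) c.1 x := by
      by_contra h
      exact hne (huniq c _ (hn hc') h).symm
    have k₃ : ¬ T.G.SameSide s(x, (β b).1) b.1 c.1 := fun k => k₁ (k.trans k₂)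
    have k₄ := hc.sameSide_of_not k₁ (T.isTree.isAcyclic.not_sameSide (hadj _))
    have hf : f ≠ s(x, (β b).1) := by
      rintro rfl
      exact k₃ h₁
    have k₅ := ((hadj (β b)).sameSide hf).symm
    have k₆ := (k₄.compat k₂ k₃ h₁ k₅).trans k₅
    by_cases hfa : f = s(a, x)
    · subst hfa
      exact not_sameSide_of_unique (fun y => eq_of_adj ha hx) (hn hd') h₂
    · exact h₃ (k₆.trans (hx.sameSide hfa).symm)
  · obtain ⟨w, hw, hs⟩ := exists_isLeaf_not_sameSide (hadj y)
    have hwa : w ≠ a := by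
      rintro rfl
      exact hs (hax y)
    exact ⟨⟨w, hw⟩, fun h => hwa (congrArg Subtype.val h), huniq _ _ hwa hs⟩

end FinTree
end Paper

/-! # The measure of a tree -/

namespace Paper
open SimpleGraph

theorem ratFunc_X_sub_one_ne_zero : (RatFunc.X - 1 : RatFunc ℚ) ≠ 0 := by
  rw [← RatFunc.algebraMap_X, ← map_one (algebraMap (Polynomial ℚ) (RatFunc ℚ)), ← map_sub]
  exact RatFunc.algebraMap_ne_zero (Polynomial.X_sub_C_ne_zero 1)

/-- The contribution of a vertex of valence `d` to the measure of a tree. -/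
noncomputable def vertexWeight (d : ℕ) : RatFunc ℚ :=
  if d ≤ 1 then (RatFunc.X - 1)⁻¹ else if d = 2 then 1 else -fallingTau d

theorem vertexWeight_of_le_one {d : ℕ} (h : d ≤ 1) : vertexWeight d = (RatFunc.X - 1)⁻¹ :=
  if_pos h

theorem vertexWeight_two : vertexWeight 2 = 1 := rfl

theorem vertexWeight_of_three_le {d : ℕ} (h : 3 ≤ d) : vertexWeight d = -fallingTau d := by
  rw [vertexWeight, if_neg (by omega), if_neg (by omega)]

theorem fallingTau_three : fallingTau 3 = RatFunc.X - 2 := by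
  simp [fallingTau]

theorem fallingTau_succ {d : ℕ} (h : 2 ≤ d) :
    fallingTau (d + 1) = fallingTau d * (RatFunc.X - (d : RatFunc ℚ)) := by
  obtain ⟨k, rfl⟩ := Nat.exists_eq_add_of_le' h
  rw [fallingTau, fallingTau, show k + 2 + 1 - 2 = k + 1 by omega, Finset.prod_range_succ,
    Nat.add_sub_cancel]
  push_cast
  rfl

namespace FinTree

variable {T : FinTree} {a x : T.V} {ha : T.G.degree a = 1}

theorem prod_vertexWeight_erase (hx : T.G.Adj a x) {r : RatFunc ℚ}
    (hr : vertexWeight 1 * vertexWeight (T.G.degree x) =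
      r * vertexWeight (T.G.degree x - 1)) :
    ∏ v, vertexWeight (T.G.degree v) =
      r * ∏ v, vertexWeight ((T.erase a ha).G.degree v) := by
  have h₁ : ∏ v, vertexWeight ((T.erase a ha).G.degree v) =
      ∏ v ∈ Finset.univ.erase a,
        vertexWeight (if v = x then T.G.degree x - 1 else T.G.degree v) := by
    refine Finset.prod_bij (fun v _ => v.1) (fun v _ => Finset.mem_erase.2 ⟨v.2, Finset.mem_univ _⟩)
      (fun _ _ _ _ h => Subtype.ext h)
      (fun v hv => ⟨⟨v, Finset.ne_of_mem_erase hv⟩, Finset.mem_univ _, rfl⟩) fun v _ => ?_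
    split_ifs with h
    · rw [degree_erase_of_adj (h ▸ hx), h]
    · rw [degree_erase_of_not_adj fun h' => h (eq_of_adj ha hx h')]
  have hxa : x ∈ Finset.univ.erase a := Finset.mem_erase.2 ⟨hx.ne', Finset.mem_univ _⟩
  rw [h₁, ← Finset.mul_prod_erase _ _ (Finset.mem_univ a), ha, ← Finset.mul_prod_erase _ _ hxa,
    ← Finset.mul_prod_erase _ _ hxa, if_pos rfl, ← mul_assoc, ← mul_assoc, hr]
  congr 1
  refine Finset.prod_congr rfl fun v hv => ?_
  rw [if_neg (Finset.ne_of_mem_erase hv)]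

/-- The product of the weights of the vertices of a reduced tree is its measure. -/
theorem prod_vertexWeight_eq (hred : T.Reduced) :
    RatFunc.X * ∏ v, vertexWeight (T.G.degree v) = treeMuTau T := by
  have h₁ : ∏ v ∈ T.leafFinset, vertexWeight (T.G.degree v) =
      ((RatFunc.X - 1)⁻¹) ^ T.nLeaves := by
    rw [nLeaves, ← Finset.prod_const]
    exact Finset.prod_congr rfl fun v hv => vertexWeight_of_le_one (Finset.mem_filter.1 hv).2
  have h₂ : ∏ v ∈ T.nodeFinset, vertexWeight (T.G.degree v) =
      (-1) ^ T.nNodes * ∏ v ∈ T.nodeFinset, fallingTau (T.G.degree v) := by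
    rw [nNodes, ← Finset.prod_neg]
    refine Finset.prod_congr rfl fun v hv => vertexWeight_of_three_le ?_
    have h₃ : ¬ T.G.degree v ≤ 1 := (Finset.mem_filter.1 hv).2
    have h₄ := hred v
    omega
  rw [← Finset.prod_filter_mul_prod_filter_not Finset.univ T.IsLeaf]
  change _ * ((∏ v ∈ T.leafFinset, _) * ∏ v ∈ T.nodeFinset, _) = _
  rw [h₁, h₂, treeMuTau]
  ring

theorem eq_or_eq_of_degree_eq_one (ha : T.G.degree a = 1) (hx : T.G.Adj a x)
    (hd : T.G.degree x = 1) (v : T.V) : v = a ∨ v = x := by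
  by_contra! h
  have n := not_sameSide_of_unique (b := v) (fun y => eq_of_adj hd hx.symm (y := y)) h.2
  have m := sameSide_of_ne ha hx h.1 hx.ne'
  rw [Sym2.eq_swap] at m
  exact n m.symm

theorem leafStruc_xmStruc_one [Subsingleton T.V] (a : T.leafStruc.carrier) :
    ∃ f : Emb (XmStruc 1) T.leafStruc, f.IsIso ∧ f.toFun (0 : Fin 1) = a := by
  refine ⟨⟨fun _ => a, fun _ _ _ => Subsingleton.elim (α := Fin 1) _ _, fun i v => ?_⟩,
    fun b => ⟨(0 : Fin 1), Subtype.ext (Subsingleton.elim _ _)⟩, rfl⟩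
  refine iff_of_false (fun h => ?_) id
  simpa using h.1

theorem leafStruc_xmStruc_two (ha : T.G.degree a = 1) (hx : T.G.Adj a x)
    (hd : T.G.degree x = 1) :
    ∃ f : Emb (XmStruc 2) T.leafStruc, f.IsIso ∧
      f.toFun (0 : Fin 2) = ⟨a, isLeaf_of_degree ha⟩ := by
  let b : T.leafStruc.carrier := ⟨a, isLeaf_of_degree ha⟩
  let c : T.leafStruc.carrier := ⟨x, isLeaf_of_degree hd⟩
  have hbc : b ≠ c := fun h => hx.ne (congrArg Subtype.val h)
  have hall : ∀ d : T.leafStruc.carrier, d = b ∨ d = c := fun d =>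
    (eq_or_eq_of_degree_eq_one ha hx hd d.1).imp Subtype.ext Subtype.ext
  refine ⟨⟨(![b, c] : Fin 2 → _), ?_, fun i v => ?_⟩, fun d => ?_, rfl⟩
  · intro i j h
    change Fin 2 at i j
    fin_cases i <;> fin_cases j
    · rfl
    · exact absurd h hbc
    · exact absurd h.symm hbc
    · rfl
  · refine iff_of_false (fun h => ?_) id
    have hn := h.1
    have e : ∀ j : Fin 2, (![b, c] j).1 = a ∨ (![b, c] j).1 = x := fun j =>
      eq_or_eq_of_degree_eq_one ha hx hd _
    have e₀ := e (v 0)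
    have e₁ := e (v 1)
    have e₂ := e (v 2)
    simp only [List.nodup_cons, List.mem_cons, not_or] at hn
    grind
  · rcases hall d with rfl | rfl
    · exact ⟨(0 : Fin 2), rfl⟩
    · exact ⟨(1 : Fin 2), rfl⟩

end FinTree

/-- The measure of the class of `∅ → L(T)` is a product over the vertices of `T`. -/
theorem map_thetaClass_leafStruc {φ : ThetaRing TreeClass →+* RatFunc ℚ}
    (h₁ : SendsExt φ (XmStruc 1) (0 : Fin 1) (RatFunc.X / (RatFunc.X - 1)))
    (h₂ : SendsExt φ (XmStruc 2) (0 : Fin 2) (RatFunc.X - 1)⁻¹)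
    (h₃ : SendsExt φ (XmStruc 3) (0 : Fin 3) (-(RatFunc.X - 2) / (RatFunc.X - 1)))
    (h₄ : ∀ m (hm : 4 ≤ m), SendsExt φ (XmStruc m) (⟨0, Nat.zero_lt_of_lt hm⟩ : Fin m)
      ((RatFunc.X - ((m : RatFunc ℚ) - 1)) / (RatFunc.X - 1)))
    (hY : SendsExt φ YStruc (0 : Fin 4) (-(RatFunc.X - 2) / (RatFunc.X - 1)))
    (hZ : SendsExt φ ZStruc (4 : Fin 5) (-(RatFunc.X - 2) / (RatFunc.X - 1)))
    (T : FinTree) (f : Emb (emptyStruc treeSig) T.leafStruc) :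
    φ (thetaClass (emptyStruc treeSig) T.leafStruc emptyStruc_mem_treeClass
      (leafStruc_mem_treeClass T) f) = RatFunc.X * ∏ v, vertexWeight (T.G.degree v) := by
  induction hn : Fintype.card T.V using Nat.strong_induction_on generalizing T with
  | _ n ih =>
  subst hn
  have hX := ratFunc_X_sub_one_ne_zero
  rcases subsingleton_or_nontrivial T.V with hV | hV
  · obtain ⟨a⟩ := T.isTree.connected.nonempty
    have hd : ∀ v, T.G.degree v ≤ 1 := fun v => by
      rw [← card_neighborFinset_eq_degree]
      exact Finset.card_le_one_of_subsingleton _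
    have hf : IsOnePointExt f ⟨a, hd a⟩ := by
      ext b
      refine iff_of_false (fun ⟨w, _⟩ => w.elim) fun h => h (Subtype.ext (Subsingleton.elim _ _))
    rw [h₁ _ _ _ (FinTree.leafStruc_xmStruc_one _) _ _ _ hf, Finset.prod_congr rfl
      fun v _ => vertexWeight_of_le_one (hd v), Finset.prod_const, Finset.card_univ,
      Fintype.card_eq_one_iff.2 ⟨a, fun b => Subsingleton.elim _ _⟩, pow_one, div_eq_mul_inv]
  obtain ⟨a, ha⟩ : ∃ a, T.G.degree a = 1 := by
    obtain ⟨a, h⟩ := T.G.exists_minimal_degree_vertex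
    exact ⟨a, h ▸ T.isTree.minDegree_eq_one_of_nontrivial⟩
  obtain ⟨x, hx, -⟩ := degree_eq_one_iff_existsUnique_adj.1 ha
  let f' : Emb (emptyStruc treeSig) (T.erase a ha).leafStruc :=
    ⟨fun w => w.elim, fun w => w.elim, fun i v => (v ⟨0, treeSig.arity_pos i⟩).elim⟩
  have ih' := ih _ FinTree.card_erase_lt (T.erase a ha) f' rfl
  suffices h : ∃ g : Emb (T.erase a ha).leafStruc T.leafStruc,
      vertexWeight 1 * vertexWeight (T.G.degree x) =
        φ (thetaClass _ _ (leafStruc_mem_treeClass _) (leafStruc_mem_treeClass _) g) *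
          vertexWeight (T.G.degree x - 1) by
    obtain ⟨g, hg⟩ := h
    have hf : f = g.comp f' := Emb.ext_toFun fun w => w.elim
    rw [hf, thetaClass_comp _ (leafStruc_mem_treeClass _), map_mul, ih',
      FinTree.prod_vertexWeight_erase (ha := ha) hx hg]
    ring
  have hpos : 0 < T.G.degree x := T.isTree.connected.preconnected.degree_pos_of_nontrivial x
  by_cases hd₂ : T.G.degree x = 2
  · obtain ⟨g, hg⟩ := FinTree.exists_iso_erase (ha := ha) hx hd₂
    exact ⟨g, by rw [thetaClass_iso _ _ hg, map_one, hd₂, vertexWeight_two, mul_comm]⟩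
  obtain ⟨g, hg⟩ := FinTree.exists_onePointExt_erase (ha := ha) hx hd₂
  refine ⟨g, ?_⟩
  by_cases hd₁ : T.G.degree x = 1
  · rw [h₂ _ _ _ (FinTree.leafStruc_xmStruc_two ha hx hd₁) _ _ _ hg, hd₁,
      vertexWeight_of_le_one le_rfl, vertexWeight_of_le_one (Nat.zero_le 1)]
  have hd₃ : 3 ≤ T.G.degree x := by omega
  obtain ⟨β, hβ, hs⟩ := FinTree.exists_isBranching ha hx hd₃
  have hcard : Fintype.card {y // y ∈ (T.G.neighborFinset x).erase a} = T.G.degree x - 1 := by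
    rw [Fintype.card_coe, Finset.card_erase_of_mem (by simpa using hx.symm),
      card_neighborFinset_eq_degree]
  generalize T.G.degree x = d at *
  by_cases hd : d = 3
  · subst hd
    rw [hβ.map_thetaClass isQuartetStruc_of_mem_treeClass restrict_mem_treeClass hd₃ hcard
      h₃ (fun _ => hY) (fun _ => hZ) _ hs _ hg, vertexWeight_of_le_one le_rfl,
      vertexWeight_of_three_le le_rfl, vertexWeight_two, fallingTau_three]
    ring
  · have hd₄ : 4 ≤ d := by omega
    rw [hβ.map_thetaClass isQuartetStruc_of_mem_treeClass restrict_mem_treeClass hd₃ hcard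
      (h₄ d hd₄) (fun h => absurd h hd) (fun h => absurd h hd) _ hs _ hg]
    obtain ⟨k, rfl⟩ := Nat.exists_eq_add_of_le' (show 1 ≤ d by omega)
    rw [vertexWeight_of_le_one le_rfl, vertexWeight_of_three_le hd₃, Nat.add_sub_cancel,
      vertexWeight_of_three_le (by omega), fallingTau_succ (by omega)]
    push_cast
    ring

end Paper

namespace Paper

/-- **Proposition 3.7**: let `i : Θ(𝔗) ≅ ℤ[u,v]/(uv)` be the isomorphism of
Theorem 3.6, and let `μ_τ` be the composite of `i` with the homomorphism
`ℤ[u,v]/(uv) → R = ℤ[τ][1/(τ−1)]` sending `u ↦ −(τ−2)/(τ−1)`, `v ↦ 0` (computed inside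
`ℚ(τ)`, in which `R` embeds).  Then for every reduced tree `T`, the image under `μ_τ`
of the class of the embedding `∅ → L(T)` is
`(−1)^{n(T)} · τ · (τ−1)^{−ℓ(T)} · ∏_x [τ]_{v(x)}`. -/
theorem mu_tau_formula
    (e : ThetaRing TreeClass ≃+* UVQuot)
    (he₁ : SendsMarkedTo e (XmStruc 1) ⟨0, by norm_num⟩ (uP + vP + 2))
    (he₂ : SendsMarkedTo e (XmStruc 2) ⟨0, by norm_num⟩ (uP + vP + 1))
    (he₃ : SendsMarkedTo e (XmStruc 3) ⟨0, by norm_num⟩ (uP + vP))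
    (he₄ : ∀ (m : ℕ) (hm : 4 ≤ m),
      SendsMarkedTo e (XmStruc m) ⟨0, by omega⟩
        (vP + 1 - ((m : MvPolynomial (Fin 2) ℤ) - 2) * (uP + 1)))
    (heY : SendsMarkedTo e YStruc (0 : Fin 4) uP)
    (heZ : SendsMarkedTo e ZStruc (4 : Fin 5) (uP - vP))
    (g : UVQuot →+* RatFunc ℚ)
    (hgu : g (Ideal.Quotient.mk _ uP) = -(RatFunc.X - 2) / (RatFunc.X - 1))
    (hgv : g (Ideal.Quotient.mk _ vP) = 0)
    (T : FinTree) (hred : T.Reduced)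
    (f : Emb (emptyStruc treeSig) T.leafStruc) :
    g (e (thetaClass (emptyStruc treeSig) T.leafStruc emptyStruc_mem_treeClass
        (leafStruc_mem_treeClass T) f)) = treeMuTau T := by
  have hX := ratFunc_X_sub_one_ne_zero
  have key : ∀ {Pat : Struc treeSig} {pt : Pat.carrier} {p : MvPolynomial (Fin 2) ℤ}
      {c : RatFunc ℚ}, SendsMarkedTo e Pat pt p → g (Ideal.Quotient.mk _ p) = c →
      SendsExt (g.comp (e : ThetaRing TreeClass →+* UVQuot)) Pat pt c :=
    fun h hc X hX a hf W hW k hk => (congrArg g (h X hX a hf W hW k hk)).trans hc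
  rw [← FinTree.prod_vertexWeight_eq hred]
  refine map_thetaClass_leafStruc (φ := g.comp (e : ThetaRing TreeClass →+* UVQuot))
    (key he₁ ?_) (key he₂ ?_) (key he₃ ?_) (fun m hm => key (he₄ m hm) ?_) (key heY hgu)
    (key heZ ?_) T f <;>
  simp only [map_add, map_sub, map_mul, map_one, map_ofNat, map_natCast, hgu, hgv] <;>
  field_simp <;> ring

end Paper
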